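/- arXiv:2012.04523 — 2 statements merged into one kernel-verified Lean document; each statement's English description precedes it below -/
import Mathlib

section
/- Let p be an odd prime, let b, c be integers, d = b^2 - 4c, and let m be an integer satisfying (m - d)^2 = 16·m·c. If p does not divide m·d·(m-d), then ∑_{k=0}^{p-1} T_k(b,c)^2 / m^k ≡ (-1/p) + (p·d/(d-m))·(-1/p)·( q_p(d) - q_p(m) + S_{p-1}((m+d)/(4m)) - S_{p-1}((m+d)/(4d)) ) (mod p^2), where (-1/p) is the Legendre symbol and both sides are p-adic integers. -/
/-- The generalized central trinomial coefficient `T_n(b,c)`, the coefficient of `x^n`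
in `(x^2 + b*x + c)^n`. -/
def genCentralTrinomial (b c : ℤ) (n : ℕ) : ℤ :=
  ∑ k ∈ Finset.range (n / 2 + 1),
    (n.choose (2 * k) : ℤ) * ((2 * k).choose k : ℤ) * b ^ (n - 2 * k) * c ^ k

/-- The Fermat quotient `q_p(a) = (a^(p-1) - 1)/p`, viewed in `ℚ_[p]`. -/
noncomputable def fermatQuotient (p : ℕ) [Fact p.Prime] (a : ℤ) : ℚ_[p] :=
  ((a : ℚ_[p]) ^ (p - 1) - 1) / (p : ℚ_[p])

/-- `S_{p-1}(x) = ∑_{k=1}^{p-1} binom(2k,k) x^k / k`. -/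
noncomputable def Ssum (p : ℕ) [Fact p.Prime] (x : ℚ_[p]) : ℚ_[p] :=
  ∑ k ∈ Finset.Icc 1 (p - 1), ((2 * k).choose k : ℚ_[p]) * x ^ k / (k : ℚ_[p])

section Identities

variable {K : Type*} [Field K] [CharZero K]

theorem cast_choose_succ_right (n k : ℕ) :
    (n.choose (k + 1) : K) = n.choose k * ((n : K) - k) / ((k : K) + 1) := by
  have hk : (k : K) + 1 ≠ 0 := by exact_mod_cast Nat.succ_ne_zero k
  rcases le_or_gt k n with h | h
  · have := Nat.choose_succ_right_eq n k
    have h2 : (n.choose (k + 1) : K) * ((k : K) + 1) = n.choose k * ((n : K) - k) := by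
      rw [← Nat.cast_sub h]; exact_mod_cast this
    field_simp
    linear_combination h2
  · simp [Nat.choose_eq_zero_of_lt h, Nat.choose_eq_zero_of_lt (Nat.lt_succ_of_lt h)]

theorem cast_succ_choose_succ (n k : ℕ) :
    ((n + 1).choose (k + 1) : K) = n.choose k * ((n : K) + 1) / ((k : K) + 1) := by
  have hk : (k : K) + 1 ≠ 0 := by exact_mod_cast Nat.succ_ne_zero k
  have h2 : ((n : K) + 1) * n.choose k = (n + 1).choose (k + 1) * ((k : K) + 1) := by
    exact_mod_cast Nat.add_one_mul_choose_eq n k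
  field_simp
  linear_combination -h2

theorem cast_choose_two_mul_succ (k : ℕ) :
    ((2 * (k + 1)).choose (k + 1) : K) =
      (2 * k).choose k * (2 * (2 * (k : K) + 1)) / ((k : K) + 1) := by
  have hk : (k : K) + 1 ≠ 0 := by exact_mod_cast Nat.succ_ne_zero k
  have h2 : ((k : K) + 1) * (2 * (k + 1)).choose (k + 1) =
      2 * (2 * (k : K) + 1) * (2 * k).choose k := by
    exact_mod_cast Nat.succ_mul_centralBinom_succ k
  field_simp
  linear_combination h2

/-- The coefficient of `b ^ (n - 2 * k) * c ^ k` in the central trinomial coefficient. -/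
def trinomCoeff (K : Type*) [Field K] (n k : ℕ) : K :=
  n.choose (2 * k) * (2 * k).choose k

theorem trinomCoeff_succ (n k : ℕ) :
    trinomCoeff K n (k + 1) =
      trinomCoeff K n k * (((n : K) - 2 * k) * ((n : K) - 2 * k - 1)) / ((k : K) + 1) ^ 2 := by
  have hk : (k : K) + 1 ≠ 0 := by exact_mod_cast Nat.succ_ne_zero k
  have hk2 : (2 * (k : K) + 1) ≠ 0 := by exact_mod_cast Nat.succ_ne_zero (2 * k)
  have hk3 : (2 * (k : K) + 1 + 1) ≠ 0 := by exact_mod_cast Nat.succ_ne_zero (2 * k + 1)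
  simp only [trinomCoeff, cast_choose_two_mul_succ]
  rw [show 2 * (k + 1) = 2 * k + 1 + 1 by ring, cast_choose_succ_right, cast_choose_succ_right]
  push_cast
  field_simp
  ring

theorem trinomCoeff_succ_succ (n k : ℕ) :
    trinomCoeff K (n + 1) (k + 1) =
      trinomCoeff K n k * (((n : K) + 1) * ((n : K) - 2 * k)) / ((k : K) + 1) ^ 2 := by
  have hk : (k : K) + 1 ≠ 0 := by exact_mod_cast Nat.succ_ne_zero k
  have hk2 : (2 * (k : K) + 1) ≠ 0 := by exact_mod_cast Nat.succ_ne_zero (2 * k)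
  have hk3 : (2 * (k : K) + 1 + 1) ≠ 0 := by exact_mod_cast Nat.succ_ne_zero (2 * k + 1)
  simp only [trinomCoeff, cast_choose_two_mul_succ]
  rw [show 2 * (k + 1) = 2 * k + 1 + 1 by ring, cast_succ_choose_succ, cast_choose_succ_right]
  push_cast
  field_simp
  ring

theorem trinomCoeff_add_two_succ (n k : ℕ) :
    trinomCoeff K (n + 2) (k + 1) =
      trinomCoeff K n k * (((n : K) + 1) * ((n : K) + 2)) / ((k : K) + 1) ^ 2 := by
  have hk : (k : K) + 1 ≠ 0 := by exact_mod_cast Nat.succ_ne_zero k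
  have hk2 : (2 * (k : K) + 1) ≠ 0 := by exact_mod_cast Nat.succ_ne_zero (2 * k)
  have hk3 : (2 * (k : K) + 1 + 1) ≠ 0 := by exact_mod_cast Nat.succ_ne_zero (2 * k + 1)
  simp only [trinomCoeff, cast_choose_two_mul_succ]
  rw [show 2 * (k + 1) = 2 * k + 1 + 1 by ring, cast_succ_choose_succ, cast_succ_choose_succ]
  push_cast
  field_simp
  ring

theorem genCentralTrinomial_eq_sum_range (b c : ℤ) {n M : ℕ} (h : n < 2 * M) :
    (genCentralTrinomial b c n : K) =
      ∑ k ∈ Finset.range M, trinomCoeff K n k * (b : K) ^ (n - 2 * k) * (c : K) ^ k := by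
  simp only [genCentralTrinomial, trinomCoeff]
  push_cast
  refine Finset.sum_subset (Finset.range_subset_range.2 (by omega)) fun k _ hk => ?_
  rw [Nat.choose_eq_zero_of_lt (by simp at hk; omega)]
  simp

theorem trinomCoeff_eq_zero {n k : ℕ} (h : n < 2 * k) : trinomCoeff K n k = 0 := by
  simp [trinomCoeff, Nat.choose_eq_zero_of_lt h]

theorem genCentralTrinomial_recurrence (b c : ℤ) (n : ℕ) :
    ((n : K) + 2) * genCentralTrinomial b c (n + 2) =
      (2 * n + 3) * b * genCentralTrinomial b c (n + 1) -
        ((n : K) + 1) * ((b : K) ^ 2 - 4 * c) * genCentralTrinomial b c n := by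
  have h4 : (4 : K) * c * genCentralTrinomial b c n = ∑ k ∈ Finset.range (n + 1),
      4 * trinomCoeff K n k * (b : K) ^ (n - 2 * k) * (c : K) ^ (k + 1) := by
    rw [genCentralTrinomial_eq_sum_range b c (show n < 2 * (n + 1) by omega), Finset.mul_sum]
    exact Finset.sum_congr rfl fun k _ => by ring
  have h2 := genCentralTrinomial_eq_sum_range (K := K) b c
    (show n + 2 < 2 * (n + 1 + 1) by omega)
  have h1 := genCentralTrinomial_eq_sum_range (K := K) b c
    (show n + 1 < 2 * (n + 1 + 1) by omega)
  have h0 := genCentralTrinomial_eq_sum_range (K := K) b c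
    (show n < 2 * (n + 1 + 1) by omega)
  rw [Finset.sum_range_succ'] at h2 h1 h0
  have key : ∀ k, ((n : K) + 2) * (trinomCoeff K (n + 2) (k + 1) * (b : K) ^ (n + 2 - 2 * (k + 1))
      * (c : K) ^ (k + 1)) - (2 * n + 3) * b * (trinomCoeff K (n + 1) (k + 1) *
      (b : K) ^ (n + 1 - 2 * (k + 1)) * (c : K) ^ (k + 1)) +
      (n + 1) * b ^ 2 * (trinomCoeff K n (k + 1) * (b : K) ^ (n - 2 * (k + 1)) * (c : K) ^ (k + 1))
      - (n + 1) * (4 * trinomCoeff K n k * (b : K) ^ (n - 2 * k) * (c : K) ^ (k + 1)) = 0 := by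
    intro k
    have hk : (k : K) + 1 ≠ 0 := by exact_mod_cast Nat.succ_ne_zero k
    have e2 : (b : K) ^ (n + 2 - 2 * (k + 1)) = b ^ (n - 2 * k) := by
      congr 1; omega
    have e1 : trinomCoeff K (n + 1) (k + 1) * ((b : K) * b ^ (n + 1 - 2 * (k + 1))) =
        trinomCoeff K (n + 1) (k + 1) * b ^ (n - 2 * k) := by
      rcases lt_or_ge (n + 1) (2 * (k + 1)) with h | h
      · simp [trinomCoeff_eq_zero h]
      · rw [← pow_succ']; congr 2; omega
    have e0 : trinomCoeff K n (k + 1) * ((b : K) ^ 2 * b ^ (n - 2 * (k + 1))) =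
        trinomCoeff K n (k + 1) * b ^ (n - 2 * k) := by
      rcases lt_or_ge n (2 * (k + 1)) with h | h
      · simp [trinomCoeff_eq_zero h]
      · rw [← pow_add]; congr 2; omega
    have e : ((n : K) + 2) * trinomCoeff K (n + 2) (k + 1) -
        (2 * n + 3) * trinomCoeff K (n + 1) (k + 1) + (n + 1) * trinomCoeff K n (k + 1)
        - (n + 1) * (4 * trinomCoeff K n k) = 0 := by
      rw [trinomCoeff_add_two_succ, trinomCoeff_succ_succ, trinomCoeff_succ]
      field_simp
      ring
    rw [e2]
    linear_combination (b : K) ^ (n - 2 * k) * c ^ (k + 1) * e -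
      (2 * n + 3) * (c : K) ^ (k + 1) * e1 + (n + 1) * (c : K) ^ (k + 1) * e0
  have hs := Finset.sum_eq_zero (s := Finset.range (n + 1)) fun k _ => key k
  simp only [Finset.sum_sub_distrib, Finset.sum_add_distrib, ← Finset.mul_sum] at hs
  simp only [trinomCoeff, mul_zero, Nat.choose_zero_right, Nat.cast_one, Nat.sub_zero,
    pow_zero, mul_one, one_mul] at h0 h1 h2 h4 hs
  rw [← h4] at hs
  linear_combination hs + ((n : K) + 2) * h2 - (2 * n + 3) * b * h1 + (n + 1) * (b : K) ^ 2 * h0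

/-- The coefficient of `c ^ k * (b ^ 2 - 4 * c) ^ (n - k)` in the square of the `n`-th
generalized central trinomial coefficient. -/
def sqCoeff (K : Type*) [Field K] (n k : ℕ) : K :=
  (n + k).choose (2 * k) * (2 * k).choose k ^ 2

/-- The coefficients of `n * b * T_n * T_(n-1)`, in the same normalization as `sqCoeff`. -/
def mulCoeff (K : Type*) [Field K] (n k : ℕ) : K :=
  sqCoeff K n k * ((2 * k - 1) * (n : K) ^ 2 + (k : K) ^ 2) / ((2 * k - 1) * ((n : K) + k))

theorem sqCoeff_eq_zero {n k : ℕ} (h : n < k) : sqCoeff K n k = 0 := by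
  simp [sqCoeff, Nat.choose_eq_zero_of_lt (show n + k < 2 * k by omega)]

theorem mulCoeff_eq_zero {n k : ℕ} (h : n < k) : mulCoeff K n k = 0 := by
  simp [mulCoeff, sqCoeff_eq_zero h]

theorem sqCoeff_succ (n k : ℕ) :
    sqCoeff K n (k + 1) = sqCoeff K n k * (((n : K) - k) * (n + k + 1)) *
      (2 * (2 * k + 1)) / ((k : K) + 1) ^ 3 := by
  have hk : (k : K) + 1 ≠ 0 := by exact_mod_cast Nat.succ_ne_zero k
  have hk2 : (2 * (k : K) + 1) ≠ 0 := by exact_mod_cast Nat.succ_ne_zero (2 * k)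
  simp only [sqCoeff, cast_choose_two_mul_succ]
  rw [show 2 * (k + 1) = 2 * k + 1 + 1 by ring, ← add_assoc, cast_succ_choose_succ,
    cast_choose_succ_right]
  push_cast
  rw [show 2 * (k : K) + 1 + 1 = 2 * (k + 1) by ring]
  field_simp
  ring

theorem sqCoeff_succ_succ (n k : ℕ) :
    sqCoeff K (n + 1) (k + 1) = sqCoeff K n k * (((n : K) + k + 1) * (n + k + 2)) *
      (2 * (2 * k + 1)) / ((k : K) + 1) ^ 3 := by
  have hk : (k : K) + 1 ≠ 0 := by exact_mod_cast Nat.succ_ne_zero k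
  have hk2 : (2 * (k : K) + 1) ≠ 0 := by exact_mod_cast Nat.succ_ne_zero (2 * k)
  simp only [sqCoeff, cast_choose_two_mul_succ]
  rw [show 2 * (k + 1) = 2 * k + 1 + 1 by ring, show n + 1 + (k + 1) = n + k + 1 + 1 by ring,
    cast_succ_choose_succ, cast_succ_choose_succ]
  push_cast
  rw [show 2 * (k : K) + 1 + 1 = 2 * (k + 1) by ring]
  field_simp
  ring

theorem sqCoeff_pred_succ (n k : ℕ) :
    sqCoeff K n (k + 1) = sqCoeff K (n + 1) k * (((n : K) + 1 - k) * (n - k)) *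
      (2 * (2 * k + 1)) / ((k : K) + 1) ^ 3 := by
  have hk : (k : K) + 1 ≠ 0 := by exact_mod_cast Nat.succ_ne_zero k
  have hk2 : (2 * (k : K) + 1) ≠ 0 := by exact_mod_cast Nat.succ_ne_zero (2 * k)
  simp only [sqCoeff, cast_choose_two_mul_succ]
  rw [show 2 * (k + 1) = 2 * k + 1 + 1 by ring, show n + (k + 1) = n + 1 + k by ring,
    cast_choose_succ_right, cast_choose_succ_right]
  push_cast
  rw [show 2 * (k : K) + 1 + 1 = 2 * (k + 1) by ring]
  field_simp
  ring

theorem mulCoeff_zero_right (n : ℕ) : mulCoeff K n 0 = n := by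
  by_cases hn : (n : K) = 0
  · simp [mulCoeff, hn]
  · simp only [mulCoeff, sqCoeff]
    simp
    field_simp

theorem sum_sqCoeff (t : K) {n M : ℕ} (h : n < M) :
    ∑ k ∈ Finset.range (n + 1), sqCoeff K n k * t ^ k =
      ∑ k ∈ Finset.range M, sqCoeff K n k * t ^ k :=
  Finset.sum_subset (Finset.range_subset_range.2 h) fun k _ hk => by
    rw [sqCoeff_eq_zero (by simp at hk; omega), zero_mul]

theorem sum_mulCoeff (t : K) {n M : ℕ} (h : n < M) :
    ∑ k ∈ Finset.range (n + 1), mulCoeff K n k * t ^ k =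
      ∑ k ∈ Finset.range M, mulCoeff K n k * t ^ k :=
  Finset.sum_subset (Finset.range_subset_range.2 h) fun k _ hk => by
    rw [mulCoeff_eq_zero (by simp at hk; omega), zero_mul]

theorem sum_mulCoeff_recurrence (t : K) (n : ℕ) :
    ∑ k ∈ Finset.range (n + 3), mulCoeff K (n + 2) k * t ^ k =
      (2 * n + 3) * (1 + 4 * t) * ∑ k ∈ Finset.range (n + 2), sqCoeff K (n + 1) k * t ^ k -
        ∑ k ∈ Finset.range (n + 2), mulCoeff K (n + 1) k * t ^ k := by
  have h4 : 4 * t * ∑ k ∈ Finset.range (n + 2), sqCoeff K (n + 1) k * t ^ k =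
      ∑ k ∈ Finset.range (n + 2), 4 * sqCoeff K (n + 1) k * t ^ (k + 1) := by
    rw [Finset.mul_sum]
    exact Finset.sum_congr rfl fun k _ => by ring
  have h1 := sum_sqCoeff t (show n + 1 < n + 2 + 1 by omega)
  have h2 := sum_mulCoeff t (show n + 1 < n + 2 + 1 by omega)
  have h3 := Finset.sum_range_succ' (fun k => mulCoeff K (n + 2) k * t ^ k) (n + 2)
  rw [Finset.sum_range_succ' _ (n + 2)] at h1 h2
  have key : ∀ k, mulCoeff K (n + 2) (k + 1) * t ^ (k + 1) -
      (2 * n + 3) * (sqCoeff K (n + 1) (k + 1) * t ^ (k + 1)) -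
      (2 * n + 3) * (4 * sqCoeff K (n + 1) k * t ^ (k + 1)) +
      mulCoeff K (n + 1) (k + 1) * t ^ (k + 1) = 0 := by
    intro k
    have hk : (k : K) + 1 ≠ 0 := by exact_mod_cast Nat.succ_ne_zero k
    have hk2 : (2 * (k : K) + 1) ≠ 0 := by exact_mod_cast Nat.succ_ne_zero (2 * k)
    have hk3 : 2 * ((k : K) + 1) - 1 ≠ 0 := by
      convert hk2 using 1; ring
    have hk4 : (n : K) + 1 + (k + 1) ≠ 0 := by exact_mod_cast Nat.succ_ne_zero (n + 1 + k)
    have hk5 : (n : K) + 2 + (k + 1) ≠ 0 := by exact_mod_cast Nat.succ_ne_zero (n + 2 + k)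
    simp only [mulCoeff]
    rw [show n + 2 = n + 1 + 1 by rfl, sqCoeff_succ_succ, sqCoeff_succ]
    push_cast
    rw [show (n : K) + 1 + 1 = n + 2 by ring]
    field_simp
    ring
  have hs := Finset.sum_eq_zero (s := Finset.range (n + 2)) fun k _ => key k
  simp only [Finset.sum_sub_distrib, Finset.sum_add_distrib, ← Finset.mul_sum] at hs
  rw [← h4] at hs
  have z1 : sqCoeff K (n + 1) 0 = 1 := by simp [sqCoeff]
  rw [z1] at h1
  rw [mulCoeff_zero_right] at h2 h3
  push_cast at h2 h3
  linear_combination hs - (2 * n + 3) * h1 + h2 + h3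

theorem sum_sqCoeff_recurrence (t : K) (n : ℕ) :
    ((n : K) + 2) ^ 2 * ∑ k ∈ Finset.range (n + 3), sqCoeff K (n + 2) k * t ^ k =
      (2 * n + 3) ^ 2 * (1 + 4 * t) * ∑ k ∈ Finset.range (n + 2), sqCoeff K (n + 1) k * t ^ k -
        2 * (2 * n + 3) * ∑ k ∈ Finset.range (n + 2), mulCoeff K (n + 1) k * t ^ k +
        (n + 1) ^ 2 * ∑ k ∈ Finset.range (n + 1), sqCoeff K n k * t ^ k := by
  have h4 : 4 * t * ∑ k ∈ Finset.range (n + 2), sqCoeff K (n + 1) k * t ^ k =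
      ∑ k ∈ Finset.range (n + 2), 4 * sqCoeff K (n + 1) k * t ^ (k + 1) := by
    rw [Finset.mul_sum]
    exact Finset.sum_congr rfl fun k _ => by ring
  have h0 := sum_sqCoeff t (show n < n + 2 + 1 by omega)
  have h1 := sum_sqCoeff t (show n + 1 < n + 2 + 1 by omega)
  have h2 := sum_mulCoeff t (show n + 1 < n + 2 + 1 by omega)
  have h3 := Finset.sum_range_succ' (fun k => sqCoeff K (n + 2) k * t ^ k) (n + 2)
  rw [Finset.sum_range_succ' _ (n + 2)] at h0 h1 h2
  have key : ∀ k, ((n : K) + 2) ^ 2 * (sqCoeff K (n + 2) (k + 1) * t ^ (k + 1)) -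
      (2 * n + 3) ^ 2 * (sqCoeff K (n + 1) (k + 1) * t ^ (k + 1)) -
      (2 * n + 3) ^ 2 * (4 * sqCoeff K (n + 1) k * t ^ (k + 1)) +
      2 * (2 * n + 3) * (mulCoeff K (n + 1) (k + 1) * t ^ (k + 1)) -
      (n + 1) ^ 2 * (sqCoeff K n (k + 1) * t ^ (k + 1)) = 0 := by
    intro k
    have hk : (k : K) + 1 ≠ 0 := by exact_mod_cast Nat.succ_ne_zero k
    have hk2 : (2 * (k : K) + 1) ≠ 0 := by exact_mod_cast Nat.succ_ne_zero (2 * k)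
    have hk3 : 2 * ((k : K) + 1) - 1 ≠ 0 := by
      convert hk2 using 1; ring
    have hk4 : (n : K) + 1 + (k + 1) ≠ 0 := by exact_mod_cast Nat.succ_ne_zero (n + 1 + k)
    simp only [mulCoeff]
    rw [show n + 2 = n + 1 + 1 by rfl, sqCoeff_succ_succ, sqCoeff_succ, sqCoeff_pred_succ n]
    push_cast
    field_simp
    ring
  have hs := Finset.sum_eq_zero (s := Finset.range (n + 2)) fun k _ => key k
  simp only [Finset.sum_sub_distrib, Finset.sum_add_distrib, ← Finset.mul_sum] at hs
  rw [← h4] at hs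
  have z0 : ∀ n, sqCoeff K n 0 = 1 := by simp [sqCoeff]
  rw [z0] at h0 h1 h3
  rw [mulCoeff_zero_right] at h2
  push_cast at h2
  linear_combination hs + ((n : K) + 2) ^ 2 * h3 - (2 * n + 3) ^ 2 * h1 +
    2 * (2 * n + 3) * h2 - (n + 1) ^ 2 * h0

theorem genCentralTrinomial_sq_aux (b c : ℤ) {d t : K} (hd : (d : K) = (b : K) ^ 2 - 4 * c)
    (ht : (c : K) = d * t) (n : ℕ) :
    (genCentralTrinomial b c n : K) ^ 2 =
        d ^ n * ∑ k ∈ Finset.range (n + 1), sqCoeff K n k * t ^ k ∧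
      (genCentralTrinomial b c (n + 1) : K) ^ 2 =
        d ^ (n + 1) * ∑ k ∈ Finset.range (n + 2), sqCoeff K (n + 1) k * t ^ k ∧
      ((n : K) + 1) * b * (genCentralTrinomial b c (n + 1) * genCentralTrinomial b c n) =
        d ^ (n + 1) * ∑ k ∈ Finset.range (n + 2), mulCoeff K (n + 1) k * t ^ k := by
  have hb : (b : K) ^ 2 = d * (1 + 4 * t) := by linear_combination -hd + 4 * ht
  induction n with
  | zero =>
    have two : (2 - 1 : K) = 1 := by norm_num
    have two' : (1 + 1 : K) ≠ 0 := by norm_num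
    simp [genCentralTrinomial, sqCoeff, mulCoeff, Finset.sum_range_succ, two]
    refine ⟨by linear_combination hb, ?_⟩
    field_simp
    linear_combination hb
  | succ n ih =>
    obtain ⟨h0, h1, hm⟩ := ih
    have hrec := genCentralTrinomial_recurrence (K := K) b c n
    rw [← hd] at hrec
    have hn2 : (n : K) + 2 ≠ 0 := by exact_mod_cast Nat.succ_ne_zero (n + 1)
    have r1 := sum_mulCoeff_recurrence t n
    have r2 := sum_sqCoeff_recurrence t n
    refine ⟨h1, ?_, ?_⟩
    · refine mul_left_cancel₀ (pow_ne_zero 2 hn2) ?_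
      rw [mul_left_comm, r2, ← mul_pow, hrec]
      linear_combination (2 * (n : K) + 3) ^ 2 * (genCentralTrinomial b c (n + 1) : K) ^ 2 * hb +
        (2 * (n : K) + 3) ^ 2 * (d * (1 + 4 * t)) * h1 - 2 * (2 * n + 3) * d * hm +
        (n + 1) ^ 2 * d ^ 2 * h0
    · rw [r1]
      push_cast
      linear_combination b * genCentralTrinomial b c (n + 1) * hrec +
        (2 * (n : K) + 3) * (genCentralTrinomial b c (n + 1) : K) ^ 2 * hb +
        (2 * (n : K) + 3) * (d * (1 + 4 * t)) * h1 - d * hm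

theorem genCentralTrinomial_sq (b c : ℤ) {d t : K} (hd : (d : K) = (b : K) ^ 2 - 4 * c)
    (ht : (c : K) = d * t) {n M : ℕ} (h : n < M) :
    (genCentralTrinomial b c n : K) ^ 2 =
      d ^ n * ∑ k ∈ Finset.range M, sqCoeff K n k * t ^ k := by
  rw [← sum_sqCoeff t h]
  exact (genCentralTrinomial_sq_aux b c hd ht n).1

theorem alternating_sum_choose_succ_mul (M : ℕ) (f : ℕ → K) :
    ∑ i ∈ Finset.range (M + 2), (-1) ^ i * ((M + 1).choose i : K) * f i =
      ∑ i ∈ Finset.range (M + 1), (-1) ^ i * (M.choose i : K) * (f i - f (i + 1)) := by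
  have h1 := Finset.sum_range_succ (fun i => (-1) ^ i * (M.choose i : K) * f i) (M + 1)
  rw [Finset.sum_range_succ' _ (M + 1), Nat.choose_eq_zero_of_lt (Nat.lt_succ_self M)] at h1
  rw [Finset.sum_range_succ' _ (M + 1)]
  simp only [Nat.choose_succ_succ, Nat.cast_add, mul_sub, mul_add, add_mul,
    Finset.sum_add_distrib, Finset.sum_sub_distrib] at h1 ⊢
  simp only [pow_succ, mul_neg, mul_one, neg_mul, Finset.sum_neg_distrib] at h1 ⊢
  simp at h1 ⊢
  linear_combination h1

theorem alternating_sum_choose_mul_choose_add (M q r : ℕ) :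
    ∑ i ∈ Finset.range (M + 1), (-1) ^ i * (M.choose i : K) * ((q + i).choose (r + M) : K) =
      (-1) ^ M * q.choose r := by
  induction M with
  | zero => simp
  | succ M ih =>
    rw [alternating_sum_choose_succ_mul, pow_succ, mul_neg_one, neg_mul, ← ih,
      ← Finset.sum_neg_distrib]
    refine Finset.sum_congr rfl fun i _ => ?_
    rw [← add_assoc q, ← add_assoc r, Nat.choose_succ_succ]
    push_cast
    ring

theorem one_sub_pow_mul_sum_choose (y : K) (M N : ℕ) :
    (1 - y) ^ (M + 1) * ∑ i ∈ Finset.range (N + 1), ((i + M).choose M : K) * y ^ i =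
      1 - ((N : K) + 1) * ((N + 1 + M).choose M : K) * ∑ i ∈ Finset.range (M + 1),
        (-1) ^ i * (M.choose i : K) * (y ^ (N + 1 + i) / ((N : K) + 1 + i)) := by
  have hpow : (1 - y) ^ (M + 1) =
      ∑ i ∈ Finset.range (M + 2), (-1) ^ i * ((M + 1).choose i : K) * y ^ i := by
    rw [sub_eq_neg_add, add_pow]
    refine Finset.sum_congr rfl fun i _ => ?_
    rw [neg_pow, one_pow]; ring
  induction N with
  | zero =>
    simp only [zero_add, Finset.sum_range_one, Nat.choose_self, pow_zero, Nat.cast_zero]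
    rw [hpow, Finset.sum_range_succ', add_comm 1 M, Nat.choose_symm_of_eq_add rfl,
      Finset.mul_sum]
    simp only [pow_zero, Nat.choose_zero_right, Nat.choose_one_right, Nat.cast_one, mul_one]
    rw [add_comm, sub_eq_add_neg, ← Finset.sum_neg_distrib]
    congr 1
    refine Finset.sum_congr rfl fun i _ => ?_
    rw [cast_succ_choose_succ]
    have hi : (i : K) + 1 ≠ 0 := by exact_mod_cast Nat.succ_ne_zero i
    have hi' : 1 + (i : K) ≠ 0 := by rwa [add_comm]
    push_cast
    field_simp
    ring
  | succ N ih =>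
    rw [Finset.sum_range_succ, mul_add, ih]
    have hc : ((N : K) + 1 + 1) * ((N + 1 + 1 + M).choose M : K) =
        (N + 1 + 1 + M) * ((N + 1 + M).choose M : K) := by
      have := Nat.choose_mul_succ_eq (N + 1 + M) M
      rw [show N + 1 + M + 1 - M = N + 1 + 1 by omega,
        show N + 1 + M + 1 = N + 1 + 1 + M by ring] at this
      have h2 : ((N + 1 + M).choose M : K) * (N + 1 + 1 + M) =
        ((N + 1 + 1 + M).choose M : K) * (N + 1 + 1) := by exact_mod_cast this
      linear_combination -h2
    have key : (1 - y) ^ (M + 1) = ((N : K) + 1) * ∑ i ∈ Finset.range (M + 1),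
          (-1) ^ i * (M.choose i : K) * (y ^ i / ((N : K) + 1 + i)) -
        (N + 1 + 1 + M) * ∑ i ∈ Finset.range (M + 1),
          (-1) ^ i * (M.choose i : K) * (y ^ (i + 1) / ((N : K) + 1 + 1 + i)) := by
      have h1 := Finset.sum_range_succ
        (fun i => (-1) ^ i * (M.choose i : K) * (y ^ i / ((N : K) + 1 + i))) (M + 1)
      rw [Finset.sum_range_succ' _ (M + 1), Nat.choose_eq_zero_of_lt (Nat.lt_succ_self M)] at h1
      simp only [Nat.cast_zero, mul_zero, zero_mul, add_zero] at h1
      rw [hpow, Finset.sum_range_succ' _ (M + 1), ← h1, mul_add, Finset.mul_sum, Finset.mul_sum,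
        add_sub_right_comm, ← Finset.sum_sub_distrib]
      have hN : (N : K) + 1 ≠ 0 := by exact_mod_cast Nat.succ_ne_zero N
      congr 1
      · refine Finset.sum_congr rfl fun i _ => ?_
        have hi : (i : K) + 1 ≠ 0 := by exact_mod_cast Nat.succ_ne_zero i
        have hi2 : (N : K) + 1 + 1 + i ≠ 0 := by
          exact_mod_cast (show N + 1 + 1 + i ≠ 0 by omega)
        have hi3 : (N : K) + 1 + (i + 1) ≠ 0 := by exact_mod_cast Nat.succ_ne_zero (N + 1 + i)
        rw [cast_succ_choose_succ, cast_choose_succ_right]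
        push_cast
        field_simp
        ring
      · simp
        field_simp
    have e1 : ∑ i ∈ Finset.range (M + 1),
        (-1) ^ i * (M.choose i : K) * (y ^ (N + 1 + i) / ((N : K) + 1 + i)) =
        y ^ (N + 1) * ∑ i ∈ Finset.range (M + 1),
          (-1) ^ i * (M.choose i : K) * (y ^ i / ((N : K) + 1 + i)) := by
      rw [Finset.mul_sum]
      exact Finset.sum_congr rfl fun i _ => by rw [pow_add]; ring
    have e2 : ∑ i ∈ Finset.range (M + 1),
        (-1) ^ i * (M.choose i : K) * (y ^ (N + 1 + 1 + i) / (((N + 1 : ℕ) : K) + 1 + i)) =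
        y ^ (N + 1) * ∑ i ∈ Finset.range (M + 1),
          (-1) ^ i * (M.choose i : K) * (y ^ (i + 1) / ((N : K) + 1 + 1 + i)) := by
      rw [Finset.mul_sum]
      refine Finset.sum_congr rfl fun i _ => ?_
      push_cast
      rw [show N + 1 + 1 + i = N + 1 + (i + 1) by ring, pow_add]; ring
    rw [e1, e2]
    push_cast
    linear_combination ((N + 1 + M).choose M : K) * y ^ (N + 1) * key + (y ^ (N + 1) *
      ∑ i ∈ Finset.range (M + 1),
          (-1) ^ i * (M.choose i : K) * (y ^ (i + 1) / ((N : K) + 1 + 1 + i))) * hc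

/-- The signed coefficients of the shifted Legendre polynomial of degree `h`. -/
def legendreCoeff (K : Type*) [Field K] (h k : ℕ) : K :=
  (-1) ^ k * h.choose k * (h + k).choose k

theorem sum_legendreCoeff_mul_choose_div (h j : ℕ) (hj : j ≤ h) :
    ∑ k ∈ Finset.range (h + 1),
      legendreCoeff K h k * ((2 * k).choose (k + j) / (2 * k).choose k) = (-1) ^ h := by
  obtain ⟨M, rfl⟩ := Nat.exists_eq_add_of_le hj
  rw [add_assoc, Finset.sum_range_add, Finset.sum_eq_zero, zero_add]
  · have := alternating_sum_choose_mul_choose_add (K := K) M (2 * j + M) 0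
    rw [zero_add, Nat.choose_zero_right, Nat.cast_one, mul_one] at this
    rw [pow_add, ← this, Finset.mul_sum]
    refine Finset.sum_congr rfl fun i hi => ?_
    obtain ⟨l, rfl⟩ := Nat.exists_eq_add_of_le (Nat.lt_succ_iff.1 (Finset.mem_range.1 hi))
    simp only [legendreCoeff]
    have c1 := Nat.cast_add_choose K (a := j + i) (b := l)
    have c2 := Nat.cast_add_choose K (a := j + i) (b := j + i + l)
    have c3 := Nat.cast_add_choose K (a := j + i + j) (b := i)
    have c4 := Nat.cast_add_choose K (a := j + i) (b := j + i)
    have c5 := Nat.cast_add_choose K (a := i) (b := l)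
    have c6 := Nat.cast_add_choose K (a := i + l) (b := j + i + j)
    rw [show j + (i + l) + (j + i) = j + i + (j + i + l) by ring, ← add_assoc j,
      show 2 * (j + i) = j + i + (j + i) by ring, c4, c2, c1,
      show j + i + (j + i) = j + i + j + i by ring, c3,
      show 2 * j + (i + l) + i = i + l + (j + i + j) by ring, c6, c5,
      show i + l + (j + i + j) = j + i + (j + i + l) by ring,
      show j + i + j + i = j + i + (j + i) by ring]
    have hf : ∀ n : ℕ, (n.factorial : K) ≠ 0 := fun n =>
      Nat.cast_ne_zero.2 (Nat.factorial_ne_zero n)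
    have f1 := hf (j + i)
    have f2 := hf l
    have f3 := hf (j + i + l)
    have f4 := hf (j + i + j)
    have f5 := hf i
    have f6 := hf (i + l)
    have f7 := hf (j + i + (j + i))
    field_simp
    ring
  · intro k hk
    rw [Nat.choose_eq_zero_of_lt (show 2 * k < k + j by simp at hk; omega)]
    simp

theorem sum_choose_mul_pow_div (u : K) (h : ℕ) :
    ∑ k ∈ Finset.range h, (-1) ^ (k + 1) * (h.choose (k + 1) : K) * u ^ (k + 1) / ((k : K) + 1) =
      ∑ j ∈ Finset.range h, ((1 - u) ^ (j + 1) - 1) / ((j : K) + 1) := by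
  induction h with
  | zero => simp
  | succ h ih =>
    have hh : (h : K) + 1 ≠ 0 := by exact_mod_cast Nat.succ_ne_zero h
    have hpow : (1 - u) ^ (h + 1) - 1 = ∑ k ∈ Finset.range (h + 1),
        (-1) ^ (k + 1) * ((h + 1).choose (k + 1) : K) * u ^ (k + 1) := by
      rw [sub_eq_neg_add 1 u, add_pow, Finset.sum_range_succ' _ (h + 1)]
      simp only [one_pow, pow_zero, Nat.choose_zero_right, Nat.cast_one, mul_one,
        add_sub_cancel_right]
      refine Finset.sum_congr rfl fun i _ => ?_
      rw [neg_pow]; ring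
    rw [Finset.sum_range_succ (fun j => ((1 - u) ^ (j + 1) - 1) / ((j : K) + 1)), ← ih, hpow,
      Finset.sum_div]
    have h1 := Finset.sum_range_succ
      (fun k => (-1) ^ (k + 1) * (h.choose (k + 1) : K) * u ^ (k + 1) / ((k : K) + 1)) h
    rw [Nat.choose_eq_zero_of_lt (Nat.lt_succ_self h)] at h1
    simp only [Nat.cast_zero, mul_zero, zero_mul, zero_div, add_zero] at h1
    rw [← h1, ← Finset.sum_add_distrib]
    refine Finset.sum_congr rfl fun k _ => ?_
    have hk : (k : K) + 1 ≠ 0 := by exact_mod_cast Nat.succ_ne_zero k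
    rw [cast_succ_choose_succ, cast_choose_succ_right]
    field_simp
    ring

end Identities

theorem sum_range_two_mul_add_one {G : Type*} [AddCommMonoid G] (f : ℕ → G) (k : ℕ) :
    ∑ i ∈ Finset.range (2 * k + 1), f i =
      f k + ∑ j ∈ Finset.range k, (f (k + (j + 1)) + f (k - (j + 1))) := by
  rw [show 2 * k + 1 = k + (k + 1) by ring, Finset.sum_range_add, Finset.sum_range_succ',
    Finset.sum_add_distrib, ← Finset.sum_range_reflect f k]
  simp only [Nat.sub_sub, add_comm 1, add_zero]
  abel

section PadicCongruence

variable {p : ℕ} [Fact p.Prime]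

/-- The `p`-adic numbers divisible by `p ^ r` in the ring of `p`-adic integers. -/
def padicBall (p : ℕ) [Fact p.Prime] (r : ℕ) : AddSubgroup ℚ_[p] where
  carrier := {x | ‖x‖ ≤ (p : ℝ)⁻¹ ^ r}
  zero_mem' := by simp only [Set.mem_ofPred_eq, norm_zero]; positivity
  add_mem' hx hy := (Padic.nonarchimedean _ _).trans (max_le hx hy)
  neg_mem' hx := by simpa using hx

theorem mem_padicBall {r : ℕ} {x : ℚ_[p]} : x ∈ padicBall p r ↔ ‖x‖ ≤ (p : ℝ)⁻¹ ^ r := Iff.rfl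

theorem mul_mem_padicBall {r s : ℕ} {x y : ℚ_[p]} (hx : x ∈ padicBall p r)
    (hy : y ∈ padicBall p s) : x * y ∈ padicBall p (r + s) := by
  rw [mem_padicBall, norm_mul, pow_add]
  exact mul_le_mul hx hy (norm_nonneg _) (by positivity)

theorem mul_mem_padicBall_left {r : ℕ} {x y : ℚ_[p]} (hx : x ∈ padicBall p 0)
    (hy : y ∈ padicBall p r) : x * y ∈ padicBall p r := by
  simpa using mul_mem_padicBall hx hy

theorem mul_mem_padicBall_right {r : ℕ} {x y : ℚ_[p]} (hx : x ∈ padicBall p r)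
    (hy : y ∈ padicBall p 0) : x * y ∈ padicBall p r :=
  mul_mem_padicBall hx hy

theorem padicBall_anti {r s : ℕ} (h : r ≤ s) {x : ℚ_[p]} (hx : x ∈ padicBall p s) :
    x ∈ padicBall p r := by
  have hp : (1 : ℝ) ≤ p := by exact_mod_cast (Fact.out : p.Prime).one_le
  exact hx.trans (pow_le_pow_of_le_one (by positivity) (inv_le_one_of_one_le₀ hp) h)

theorem natCast_mem_padicBall (n : ℕ) : (n : ℚ_[p]) ∈ padicBall p 0 := by
  simpa [mem_padicBall] using Padic.norm_int_le_one (p := p) n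

theorem intCast_mem_padicBall (n : ℤ) : (n : ℚ_[p]) ∈ padicBall p 0 := by
  simpa [mem_padicBall] using Padic.norm_int_le_one (p := p) n

theorem one_mem_padicBall : (1 : ℚ_[p]) ∈ padicBall p 0 := by
  simpa using natCast_mem_padicBall (p := p) 1

theorem prime_mem_padicBall : (p : ℚ_[p]) ∈ padicBall p 1 := by
  rw [mem_padicBall, Padic.norm_p, pow_one]

theorem pow_mem_padicBall {x : ℚ_[p]} (hx : x ∈ padicBall p 0) (n : ℕ) :
    x ^ n ∈ padicBall p 0 := by
  induction n with
  | zero => simpa using one_mem_padicBall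
  | succ n ih => rw [pow_succ]; exact mul_mem_padicBall ih hx

theorem mem_padicBall_zero {x : ℚ_[p]} (hx : ‖x‖ = 1) : x ∈ padicBall p 0 := by
  simp [mem_padicBall, hx]

theorem inv_mem_padicBall {x : ℚ_[p]} (hx : ‖x‖ = 1) : x⁻¹ ∈ padicBall p 0 := by
  simp [mem_padicBall, hx]

theorem mem_padicBall_of_mul {r : ℕ} {u x : ℚ_[p]} (hu : ‖u‖ = 1)
    (h : u * x ∈ padicBall p r) : x ∈ padicBall p r := by
  simpa [mem_padicBall, hu] using h

theorem natCast_mem_padicBall_one {n : ℕ} (h : p ∣ n) : (n : ℚ_[p]) ∈ padicBall p 1 := by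
  obtain ⟨k, rfl⟩ := h
  push_cast
  exact mul_mem_padicBall_right prime_mem_padicBall (natCast_mem_padicBall k)

theorem norm_natCast_eq_one_of_lt {n : ℕ} (h0 : n ≠ 0) (h : n < p) : ‖(n : ℚ_[p])‖ = 1 :=
  Padic.norm_natCast_eq_one_iff.2
    ((Nat.Prime.coprime_iff_not_dvd Fact.out).2 fun hd => h0 (Nat.eq_zero_of_dvd_of_lt hd h))

theorem norm_choose_eq_one {n k : ℕ} (h : n < p) (hk : k ≤ n) : ‖(n.choose k : ℚ_[p])‖ = 1 :=
  Padic.norm_natCast_eq_one_iff.2 (Nat.Prime.coprime_choose_of_lt Fact.out h hk)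

theorem neg_one_pow_mem_padicBall (n : ℕ) : (-1 : ℚ_[p]) ^ n ∈ padicBall p 0 :=
  pow_mem_padicBall (neg_mem one_mem_padicBall) n

theorem intCast_pow_sub_one_mem_padicBall {a : ℤ} (ha : ¬(p : ℤ) ∣ a) :
    (a : ℚ_[p]) ^ (p - 1) - 1 ∈ padicBall p 1 := by
  have hc : IsCoprime a p :=
    ((Nat.prime_iff_prime_int.1 (Fact.out : p.Prime)).coprime_iff_not_dvd.2 ha).symm
  obtain ⟨k, hk⟩ := (Int.ModEq.pow_card_sub_one_eq_one Fact.out hc).symm.dvd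
  have : (a : ℚ_[p]) ^ (p - 1) - 1 = p * k := by exact_mod_cast hk
  rw [this]
  exact mul_mem_padicBall_right prime_mem_padicBall (intCast_mem_padicBall k)

theorem legendreCoeff_mem_padicBall (h k : ℕ) : legendreCoeff ℚ_[p] h k ∈ padicBall p 0 :=
  mul_mem_padicBall (mul_mem_padicBall (neg_one_pow_mem_padicBall k)
    (natCast_mem_padicBall _)) (natCast_mem_padicBall _)

theorem centralBinom_sq_sub_legendreCoeff {h : ℕ} (hp : p = 2 * h + 1) {k : ℕ} (hk : k ≤ h) :
    ((2 * k).choose k : ℚ_[p]) ^ 2 / 16 ^ k - legendreCoeff ℚ_[p] h k ∈ padicBall p 2 := by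
  induction k with
  | zero => simp [legendreCoeff]
  | succ k ih =>
    have hk1 : (k : ℚ_[p]) + 1 ≠ 0 := by exact_mod_cast Nat.succ_ne_zero k
    have hpc : (p : ℚ_[p]) = 2 * h + 1 := by exact_mod_cast congrArg (Nat.cast : ℕ → ℚ_[p]) hp
    have hleg : legendreCoeff ℚ_[p] h (k + 1) = legendreCoeff ℚ_[p] h k *
        ((2 * k + 1) ^ 2 - p ^ 2) / (2 * (k + 1)) ^ 2 := by
      simp only [legendreCoeff]
      rw [← add_assoc, cast_succ_choose_succ, cast_choose_succ_right, hpc]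
      push_cast
      field_simp
      ring
    have hu : ‖(2 : ℚ_[p]) * (k + 1)‖ = 1 := by
      have := norm_natCast_eq_one_of_lt (p := p) (n := 2 * (k + 1)) (by omega) (by omega)
      push_cast at this
      exact this
    have hi := pow_mem_padicBall (inv_mem_padicBall hu) 2
    have : ((2 * (k + 1)).choose (k + 1) : ℚ_[p]) ^ 2 / 16 ^ (k + 1) -
        legendreCoeff ℚ_[p] h (k + 1) = ((2 * (k : ℚ_[p]) + 1) ^ 2 * (2 * ((k : ℚ_[p]) + 1))⁻¹ ^ 2) *
          (((2 * k).choose k : ℚ_[p]) ^ 2 / 16 ^ k - legendreCoeff ℚ_[p] h k) +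
        p * p * (legendreCoeff ℚ_[p] h k * (2 * ((k : ℚ_[p]) + 1))⁻¹ ^ 2) := by
      rw [hleg, cast_choose_two_mul_succ]
      field_simp
      ring
    rw [this]
    refine add_mem (mul_mem_padicBall_left (mul_mem_padicBall (pow_mem_padicBall ?_ 2) hi)
      (ih (by omega))) (mul_mem_padicBall_right
        (mul_mem_padicBall prime_mem_padicBall prime_mem_padicBall)
        (mul_mem_padicBall (legendreCoeff_mem_padicBall h k) hi))
    have := natCast_mem_padicBall (p := p) (2 * k + 1)
    push_cast at this
    exact this

theorem centralBinom_sub_choose {h : ℕ} (hp : p = 2 * h + 1) {k : ℕ} (hk : k ≤ h) :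
    ((2 * k).choose k : ℚ_[p]) / 4 ^ k - (-1) ^ k * h.choose k ∈ padicBall p 1 := by
  induction k with
  | zero => simp
  | succ k ih =>
    have hk1 : (k : ℚ_[p]) + 1 ≠ 0 := by exact_mod_cast Nat.succ_ne_zero k
    have hpc : (p : ℚ_[p]) = 2 * h + 1 := by exact_mod_cast congrArg (Nat.cast : ℕ → ℚ_[p]) hp
    have hu : ‖(2 : ℚ_[p]) * (k + 1)‖ = 1 := by
      have := norm_natCast_eq_one_of_lt (p := p) (n := 2 * (k + 1)) (by omega) (by omega)
      push_cast at this
      exact this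
    have hi := inv_mem_padicBall hu
    have : ((2 * (k + 1)).choose (k + 1) : ℚ_[p]) / 4 ^ (k + 1) -
        (-1) ^ (k + 1) * h.choose (k + 1) =
        ((2 * (k : ℚ_[p]) + 1) * (2 * ((k : ℚ_[p]) + 1))⁻¹) *
          (((2 * k).choose k : ℚ_[p]) / 4 ^ k - (-1) ^ k * h.choose k) +
        p * ((-1) ^ k * h.choose k * (2 * ((k : ℚ_[p]) + 1))⁻¹) := by
      rw [cast_choose_succ_right h k, cast_choose_two_mul_succ, hpc]
      field_simp
      ring
    rw [this]
    refine add_mem (mul_mem_padicBall_left (mul_mem_padicBall ?_ hi)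
      (ih (by omega))) (mul_mem_padicBall_right prime_mem_padicBall
        (mul_mem_padicBall (mul_mem_padicBall (neg_one_pow_mem_padicBall k)
          (natCast_mem_padicBall _)) hi))
    have := natCast_mem_padicBall (p := p) (2 * k + 1)
    push_cast at this
    exact this

theorem sub_mul_choose_mul_centralBinom {h : ℕ} (hp : p = 2 * h + 1) {k : ℕ} (hk : k ≤ h) :
    (-1) ^ k * ((p : ℚ_[p]) - k) * (p + k).choose (2 * k) * (2 * k).choose k / p - 1 ∈
      padicBall p 2 := by
  have hp0 : (p : ℚ_[p]) ≠ 0 := by exact_mod_cast (Fact.out : p.Prime).ne_zero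
  induction k with
  | zero => simp [hp0]
  | succ k ih =>
    have hk1 : (k : ℚ_[p]) + 1 ≠ 0 := by exact_mod_cast Nat.succ_ne_zero k
    have hk2 : (2 * (k : ℚ_[p]) + 1) ≠ 0 := by exact_mod_cast Nat.succ_ne_zero (2 * k)
    have hu : ‖(k : ℚ_[p]) + 1‖ = 1 := by
      have := norm_natCast_eq_one_of_lt (p := p) (n := k + 1) (by omega) (by omega)
      push_cast at this
      exact this
    have hi := pow_mem_padicBall (inv_mem_padicBall hu) 2
    specialize ih (by omega)
    have : (-1) ^ (k + 1) * ((p : ℚ_[p]) - (k + 1 : ℕ)) * (p + (k + 1)).choose (2 * (k + 1)) *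
        (2 * (k + 1)).choose (k + 1) / p - 1 =
        ((-1) ^ k * ((p : ℚ_[p]) - k) * (p + k).choose (2 * k) * (2 * k).choose k / p - 1) *
          (1 - p * p * ((k : ℚ_[p]) + 1)⁻¹ ^ 2) - p * p * ((k : ℚ_[p]) + 1)⁻¹ ^ 2 := by
      have hch : ((p + (k + 1)).choose (2 * (k + 1)) : ℚ_[p]) * (2 * k + 1) =
          (p + k).choose (2 * k) * ((p - k) * (p + k + 1)) / (2 * (k + 1)) := by
        rw [← add_assoc, show 2 * (k + 1) = 2 * k + 1 + 1 by ring, cast_succ_choose_succ,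
          cast_choose_succ_right]
        push_cast
        rw [show 2 * (k : ℚ_[p]) + 1 + 1 = 2 * (k + 1) by ring]
        rw [div_mul_eq_mul_div, div_mul_eq_mul_div, div_mul_eq_mul_div]
        congr 1
        rw [mul_right_comm, div_eq_iff hk2]
        ring
      have : (-1) ^ (k + 1) * ((p : ℚ_[p]) - (k + 1 : ℕ)) * (p + (k + 1)).choose (2 * (k + 1)) *
          (2 * (k + 1)).choose (k + 1) / p =
          (-1) ^ (k + 1) * ((p : ℚ_[p]) - (k + 1 : ℕ)) * (2 * k).choose k * 2 *
          ((p + (k + 1)).choose (2 * (k + 1)) * (2 * k + 1)) / (k + 1) / p := by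
        rw [cast_choose_two_mul_succ]
        ring
      rw [this, hch]
      push_cast
      field_simp
      ring
    have hpp : (p : ℚ_[p]) * p * ((k : ℚ_[p]) + 1)⁻¹ ^ 2 ∈ padicBall p 2 :=
      mul_mem_padicBall_right (mul_mem_padicBall prime_mem_padicBall prime_mem_padicBall) hi
    rw [this]
    exact sub_mem (mul_mem_padicBall_right ih
      (sub_mem one_mem_padicBall (padicBall_anti (Nat.zero_le 2) hpp))) hpp

theorem choose_div_centralBinom_mem_padicBall {h : ℕ} (hp : p = 2 * h + 1) {k : ℕ} (hk : k ≤ h)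
    (j : ℕ) : ((2 * k).choose (k + j) / (2 * k).choose k : ℚ_[p]) ∈ padicBall p 0 := by
  rw [div_eq_mul_inv]
  exact mul_mem_padicBall (natCast_mem_padicBall _)
    (inv_mem_padicBall (norm_choose_eq_one (by omega) (by omega)))

theorem inv_prime_add_sub_inv_mem_padicBall {a : ℕ} (h0 : a ≠ 0) (h : a < p) :
    ((p : ℚ_[p]) + a)⁻¹ - (a : ℚ_[p])⁻¹ ∈ padicBall p 1 := by
  have ha := norm_natCast_eq_one_of_lt h0 h
  have hpa : ‖((p + a : ℕ) : ℚ_[p])‖ = 1 :=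
    Padic.norm_natCast_eq_one_iff.2 ((Nat.Prime.coprime_iff_not_dvd Fact.out).2 fun hd =>
      h0 (Nat.eq_zero_of_dvd_of_lt ((Nat.dvd_add_right dvd_rfl).1 hd) h))
  push_cast at hpa
  have ha' : (a : ℚ_[p]) ≠ 0 := norm_ne_zero_iff.1 (by rw [ha]; exact one_ne_zero)
  have hpa' : (p : ℚ_[p]) + a ≠ 0 := norm_ne_zero_iff.1 (by rw [hpa]; exact one_ne_zero)
  have : ((p : ℚ_[p]) + a)⁻¹ - (a : ℚ_[p])⁻¹ = p * (-((a : ℚ_[p])⁻¹ * ((p : ℚ_[p]) + a)⁻¹)) := by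
    field_simp
    ring
  rw [this]
  exact mul_mem_padicBall_right prime_mem_padicBall
    (neg_mem (mul_mem_padicBall (inv_mem_padicBall ha) (inv_mem_padicBall hpa)))

theorem inv_prime_sub_add_inv_mem_padicBall {a : ℕ} (h0 : a ≠ 0) (h : a < p) :
    ((p : ℚ_[p]) - a)⁻¹ + (a : ℚ_[p])⁻¹ ∈ padicBall p 1 := by
  have ha := norm_natCast_eq_one_of_lt h0 h
  have hpa : ‖((p - a : ℕ) : ℚ_[p])‖ = 1 := norm_natCast_eq_one_of_lt (by omega) (by omega)
  rw [Nat.cast_sub h.le] at hpa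
  have ha' : (a : ℚ_[p]) ≠ 0 := norm_ne_zero_iff.1 (by rw [ha]; exact one_ne_zero)
  have hpa' : (p : ℚ_[p]) - a ≠ 0 := norm_ne_zero_iff.1 (by rw [hpa]; exact one_ne_zero)
  have : ((p : ℚ_[p]) - a)⁻¹ + (a : ℚ_[p])⁻¹ = p * ((a : ℚ_[p])⁻¹ * ((p : ℚ_[p]) - a)⁻¹) := by
    field_simp
    ring
  rw [this]
  exact mul_mem_padicBall_right prime_mem_padicBall
    (mul_mem_padicBall (inv_mem_padicBall ha) (inv_mem_padicBall hpa))

/-- The alternating sum of `y ^ j - y⁻¹ ^ j` over `j`, weighted by the `j`-th central binomial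
ratio. -/
noncomputable def centralSum (p h k : ℕ) [Fact p.Prime] (y : ℚ_[p]) : ℚ_[p] :=
  ∑ j ∈ Finset.range h, (-1) ^ (j + 1) * ((2 * k).choose (k + (j + 1)) / (2 * k).choose k) *
    ((y ^ (j + 1) - y⁻¹ ^ (j + 1)) / ((j + 1 : ℕ) : ℚ_[p]))

/-- A perturbation of `centralSum` with the denominators `j` moved to `p + j` and `j - p`. -/
noncomputable def shiftedCentralSum (p k : ℕ) [Fact p.Prime] (y : ℚ_[p]) : ℚ_[p] :=
  ∑ j ∈ Finset.range k, (-1) ^ (j + 1) * ((2 * k).choose (k + (j + 1)) / (2 * k).choose k) *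
    (y ^ (j + 1) * ((p : ℚ_[p]) + (j + 1 : ℕ))⁻¹ + y⁻¹ ^ (j + 1) * ((p : ℚ_[p]) - (j + 1 : ℕ))⁻¹)

theorem shiftedCentralSum_sub_centralSum {h : ℕ} (hp : p = 2 * h + 1) {k : ℕ} (hk : k ≤ h)
    {y : ℚ_[p]} (hy : ‖y‖ = 1) :
    shiftedCentralSum p k y - centralSum p h k y ∈ padicBall p 1 := by
  have hE : centralSum p h k y = ∑ j ∈ Finset.range k, (-1) ^ (j + 1) *
      ((2 * k).choose (k + (j + 1)) / (2 * k).choose k) *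
        ((y ^ (j + 1) - y⁻¹ ^ (j + 1)) / ((j + 1 : ℕ) : ℚ_[p])) := by
    refine (Finset.sum_subset (Finset.range_mono hk) fun j _ hj => ?_).symm
    rw [Nat.choose_eq_zero_of_lt (by simp at hj; omega)]
    simp
  rw [hE, shiftedCentralSum, ← Finset.sum_sub_distrib]
  refine sum_mem fun j hj => ?_
  have hj' := Finset.mem_range.1 hj
  rw [← mul_sub]
  refine mul_mem_padicBall_left (mul_mem_padicBall (neg_one_pow_mem_padicBall _)
    (choose_div_centralBinom_mem_padicBall hp hk _)) ?_
  have : y ^ (j + 1) * ((p : ℚ_[p]) + (j + 1 : ℕ))⁻¹ +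
        y⁻¹ ^ (j + 1) * ((p : ℚ_[p]) - (j + 1 : ℕ))⁻¹ -
        (y ^ (j + 1) - y⁻¹ ^ (j + 1)) / ((j + 1 : ℕ) : ℚ_[p]) =
      y ^ (j + 1) * (((p : ℚ_[p]) + (j + 1 : ℕ))⁻¹ - ((j + 1 : ℕ) : ℚ_[p])⁻¹) +
        y⁻¹ ^ (j + 1) * (((p : ℚ_[p]) - (j + 1 : ℕ))⁻¹ + ((j + 1 : ℕ) : ℚ_[p])⁻¹) := by
    ring
  rw [this]
  exact add_mem
    (mul_mem_padicBall_left (pow_mem_padicBall (mem_padicBall_zero hy) _)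
      (inv_prime_add_sub_inv_mem_padicBall (Nat.succ_ne_zero j) (by omega)))
    (mul_mem_padicBall_left (pow_mem_padicBall (inv_mem_padicBall hy) _)
      (inv_prime_sub_add_inv_mem_padicBall (Nat.succ_ne_zero j) (by omega)))

theorem centralSum_mem_padicBall {h : ℕ} (hp : p = 2 * h + 1) {k : ℕ} (hk : k ≤ h)
    {y : ℚ_[p]} (hy : ‖y‖ = 1) : centralSum p h k y ∈ padicBall p 0 := by
  refine sum_mem fun j hj => ?_
  have hj' := Finset.mem_range.1 hj
  rw [div_eq_mul_inv _ ((j + 1 : ℕ) : ℚ_[p])]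
  exact mul_mem_padicBall (mul_mem_padicBall (neg_one_pow_mem_padicBall _)
    (choose_div_centralBinom_mem_padicBall hp hk _)) (mul_mem_padicBall
      (sub_mem (pow_mem_padicBall (mem_padicBall_zero hy) _)
        (pow_mem_padicBall (inv_mem_padicBall hy) _))
      (inv_mem_padicBall (norm_natCast_eq_one_of_lt (Nat.succ_ne_zero j) (by omega))))

theorem sum_neg_one_pow_mul_choose_mul_pow_div {h : ℕ} (hp : p = 2 * h + 1) {k N : ℕ}
    (hk : k ≤ h) (hN : N + 1 + k = p) {y : ℚ_[p]} (hy : ‖y‖ = 1) :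
    ∑ i ∈ Finset.range (2 * k + 1), (-1) ^ i * ((2 * k).choose i : ℚ_[p]) *
        (y ^ (N + 1 + i) / ((N : ℚ_[p]) + 1 + i)) =
      y ^ p * ((-1) ^ k * (2 * k).choose k / p) * (1 + p * shiftedCentralSum p k y) := by
  have hp0 : (p : ℚ_[p]) ≠ 0 := by exact_mod_cast (Fact.out : p.Prime).ne_zero
  have hy0 : y ≠ 0 := norm_ne_zero_iff.1 (by rw [hy]; exact one_ne_zero)
  have hc0 : ((2 * k).choose k : ℚ_[p]) ≠ 0 := by
    exact_mod_cast (Nat.choose_pos (by omega : k ≤ 2 * k)).ne'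
  have hNc : (N : ℚ_[p]) + 1 + k = p := by exact_mod_cast congrArg (Nat.cast : ℕ → ℚ_[p]) hN
  have hterm : ∀ j ∈ Finset.range k,
      (-1) ^ (k + (j + 1)) * ((2 * k).choose (k + (j + 1)) : ℚ_[p]) *
          (y ^ (N + 1 + (k + (j + 1))) / ((N : ℚ_[p]) + 1 + (k + (j + 1) : ℕ))) +
        (-1) ^ (k - (j + 1)) * ((2 * k).choose (k - (j + 1)) : ℚ_[p]) *
          (y ^ (N + 1 + (k - (j + 1))) / ((N : ℚ_[p]) + 1 + (k - (j + 1) : ℕ))) =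
      y ^ p * ((-1) ^ k * (2 * k).choose k) *
        ((-1) ^ (j + 1) * ((2 * k).choose (k + (j + 1)) / (2 * k).choose k) *
          (y ^ (j + 1) * ((p : ℚ_[p]) + (j + 1 : ℕ))⁻¹ +
            y⁻¹ ^ (j + 1) * ((p : ℚ_[p]) - (j + 1 : ℕ))⁻¹)) := by
    intro j hj
    have hj' := Finset.mem_range.1 hj
    obtain ⟨a, rfl⟩ : ∃ a, k = a + (j + 1) := ⟨k - (j + 1), by omega⟩
    have hsymm : (2 * (a + (j + 1))).choose a =
        (2 * (a + (j + 1))).choose (a + (j + 1) + (j + 1)) :=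
      Nat.choose_symm_of_eq_add (by ring)
    have h1 : (N : ℚ_[p]) + 1 + (a + (j + 1) + (j + 1) : ℕ) = p + (j + 1 : ℕ) := by
      rw [← hNc]; push_cast; ring
    have h2 : (N : ℚ_[p]) + 1 + a = p - (j + 1 : ℕ) := by
      rw [← hNc]; push_cast; ring
    have h3 : (-1 : ℚ_[p]) ^ a = (-1) ^ (a + (j + 1)) * (-1) ^ (j + 1) := by
      rw [pow_add, mul_assoc, ← mul_pow]; simp
    have h4 : y ^ (N + 1 + a) = y ^ p * y⁻¹ ^ (j + 1) := by
      rw [show y ^ p = y ^ (N + 1 + a) * y ^ (j + 1) by rw [← pow_add]; congr 1; omega, mul_assoc,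
        ← mul_pow, mul_inv_cancel₀ hy0, one_pow, mul_one]
    have h5 : y ^ (N + 1 + (a + (j + 1) + (j + 1))) = y ^ p * y ^ (j + 1) := by
      rw [← pow_add]; congr 1; omega
    rw [Nat.add_sub_cancel, hsymm, h1, h2, h4, h5, h3, pow_add _ (a + (j + 1))]
    simp only [div_eq_mul_inv]
    field_simp
  rw [sum_range_two_mul_add_one, Finset.sum_congr rfl hterm, ← Finset.mul_sum, add_comm (N + 1) k,
    add_comm k (N + 1), hN, hNc, ← shiftedCentralSum]
  field_simp

theorem mul_choose_mul_sum_mem_padicBall {h : ℕ} (hp : p = 2 * h + 1) {k N : ℕ}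
    (hk : k ≤ h) (hN : N + 1 + k = p) {y : ℚ_[p]} (hy : ‖y‖ = 1) :
    ((N : ℚ_[p]) + 1) * ((N + 1 + 2 * k).choose (2 * k) : ℚ_[p]) *
        ∑ i ∈ Finset.range (2 * k + 1), (-1) ^ i * ((2 * k).choose i : ℚ_[p]) *
          (y ^ (N + 1 + i) / ((N : ℚ_[p]) + 1 + i)) -
      y ^ p * (1 + p * centralSum p h k y) ∈ padicBall p 2 := by
  have hNc : (N : ℚ_[p]) + 1 = p - k := by
    rw [eq_sub_iff_add_eq]; exact_mod_cast congrArg (Nat.cast : ℕ → ℚ_[p]) hN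
  have he := sub_mul_choose_mul_centralBinom hp hk
  have hF := shiftedCentralSum_sub_centralSum hp hk hy
  have hE := centralSum_mem_padicBall hp hk hy
  have hpF : (p : ℚ_[p]) * shiftedCentralSum p k y ∈ padicBall p 0 := by
    have := add_mem (padicBall_anti (Nat.zero_le 1) hF) hE
    rw [sub_add_cancel] at this
    exact mul_mem_padicBall (natCast_mem_padicBall p) this
  rw [sum_neg_one_pow_mul_choose_mul_pow_div hp hk hN hy, hNc,
    show N + 1 + 2 * k = p + k by omega]
  have : ((p : ℚ_[p]) - k) * ((p + k).choose (2 * k) : ℚ_[p]) *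
        (y ^ p * ((-1) ^ k * (2 * k).choose k / p) * (1 + p * shiftedCentralSum p k y)) -
      y ^ p * (1 + p * centralSum p h k y) = y ^ p * (
        ((-1) ^ k * ((p : ℚ_[p]) - k) * (p + k).choose (2 * k) * (2 * k).choose k / p - 1) *
          (1 + p * shiftedCentralSum p k y) +
        p * (shiftedCentralSum p k y - centralSum p h k y)) := by
    ring
  rw [this]
  exact mul_mem_padicBall_left (pow_mem_padicBall (mem_padicBall_zero hy) _)
    (add_mem (mul_mem_padicBall_right he (add_mem one_mem_padicBall hpF))
      (mul_mem_padicBall prime_mem_padicBall hF))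

theorem Ssum_sub_sum_mem_padicBall {h : ℕ} (hp : p = 2 * h + 1) {y : ℚ_[p]}
    (hy : y ∈ padicBall p 0) :
    Ssum p ((1 + y) / 4) - ∑ j ∈ Finset.range h, ((-y) ^ (j + 1) - 1) / ((j : ℚ_[p]) + 1) ∈
      padicBall p 1 := by
  have h2 : ‖(2 : ℚ_[p])‖ = 1 := by
    have := (Fact.out : p.Prime).two_le
    exact_mod_cast norm_natCast_eq_one_of_lt (p := p) (n := 2) two_ne_zero (by omega)
  have h4 : ‖(4 : ℚ_[p])‖ = 1 := by
    rw [show (4 : ℚ_[p]) = 2 * 2 by norm_num, norm_mul, h2, one_mul]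
  have hu : 1 + y ∈ padicBall p 0 := add_mem one_mem_padicBall hy
  have hz : (1 + y) / 4 ∈ padicBall p 0 := by
    rw [div_eq_mul_inv]
    exact mul_mem_padicBall hu (inv_mem_padicBall h4)
  have hinv : ∀ j < 2 * h, ((j + 1 : ℕ) : ℚ_[p])⁻¹ ∈ padicBall p 0 := fun j hj =>
    inv_mem_padicBall (norm_natCast_eq_one_of_lt (Nat.succ_ne_zero j) (by omega))
  have hS : Ssum p ((1 + y) / 4) = ∑ j ∈ Finset.range (h + h),
      ((2 * (j + 1)).choose (j + 1) : ℚ_[p]) * ((1 + y) / 4) ^ (j + 1) / ((j + 1 : ℕ) : ℚ_[p]) := by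
    rw [Ssum, show Finset.Icc 1 (p - 1) = Finset.Ico 1 p by ext; simp; omega,
      Finset.sum_Ico_eq_sum_range, show p - 1 = h + h by omega]
    simp only [add_comm 1]
  have hF := sum_choose_mul_pow_div (1 + y) h
  simp only [sub_add_cancel_left] at hF
  rw [hS, ← hF, Finset.sum_range_add, add_sub_right_comm, ← Finset.sum_sub_distrib]
  refine add_mem (sum_mem fun j hj => ?_) (sum_mem fun j hj => ?_)
  · have hj' := Finset.mem_range.1 hj
    have : ((2 * (j + 1)).choose (j + 1) : ℚ_[p]) * ((1 + y) / 4) ^ (j + 1) / ((j + 1 : ℕ) : ℚ_[p]) -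
        (-1) ^ (j + 1) * (h.choose (j + 1) : ℚ_[p]) * (1 + y) ^ (j + 1) / ((j : ℚ_[p]) + 1) =
        (((2 * (j + 1)).choose (j + 1) : ℚ_[p]) / 4 ^ (j + 1) - (-1) ^ (j + 1) * h.choose (j + 1)) *
          ((1 + y) ^ (j + 1) * ((j + 1 : ℕ) : ℚ_[p])⁻¹) := by
      rw [div_pow]
      push_cast
      ring
    rw [this]
    exact mul_mem_padicBall_right (centralBinom_sub_choose hp (by omega))
      (mul_mem_padicBall (pow_mem_padicBall hu _) (hinv j (by omega)))
  · have hj' := Finset.mem_range.1 hj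
    rw [div_eq_mul_inv _ ((h + j + 1 : ℕ) : ℚ_[p]), mul_assoc]
    exact mul_mem_padicBall_right
      (natCast_mem_padicBall_one (Nat.Prime.dvd_choose Fact.out (by omega) (by omega) (by omega)))
      (mul_mem_padicBall (pow_mem_padicBall hz _) (hinv _ (by omega)))

theorem sum_choose_add_mul_pow {K : Type*} [Field K] (y : K) (k M : ℕ) :
    ∑ n ∈ Finset.range (k + M), ((n + k).choose (2 * k) : K) * y ^ n =
      y ^ k * ∑ r ∈ Finset.range M, ((r + 2 * k).choose (2 * k) : K) * y ^ r := by
  rw [Finset.sum_range_add, Finset.sum_eq_zero, zero_add, Finset.mul_sum]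
  · refine Finset.sum_congr rfl fun r _ => ?_
    rw [show k + r + k = r + 2 * k by ring, pow_add]
    ring
  · intro n hn
    rw [Nat.choose_eq_zero_of_lt (by simp at hn; omega)]
    simp

theorem one_sub_mul_sum_choose_add_mul_pow {K : Type*} [Field K] [CharZero K] {y t : K}
    (ht : 16 * y * t = (1 - y) ^ 2) (k N : ℕ) :
    (1 - y) * (t ^ k * ∑ n ∈ Finset.range (k + (N + 1)), ((n + k).choose (2 * k) : K) * y ^ n) =
      (1 - ((N : K) + 1) * ((N + 1 + 2 * k).choose (2 * k) : K) *
        ∑ i ∈ Finset.range (2 * k + 1), (-1) ^ i * ((2 * k).choose i : K) *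
          (y ^ (N + 1 + i) / ((N : K) + 1 + i))) / 16 ^ k := by
  rw [sum_choose_add_mul_pow, ← one_sub_pow_mul_sum_choose, pow_succ, pow_mul, ← ht, mul_pow,
    mul_pow]
  field_simp

theorem sum_legendreCoeff_mul_centralSum {h : ℕ} (y : ℚ_[p]) :
    ∑ k ∈ Finset.range (h + 1), legendreCoeff ℚ_[p] h k * centralSum p h k y =
      (-1) ^ h * ∑ j ∈ Finset.range h,
        (-1) ^ (j + 1) * ((y ^ (j + 1) - y⁻¹ ^ (j + 1)) / ((j + 1 : ℕ) : ℚ_[p])) := by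
  simp only [centralSum, Finset.mul_sum]
  rw [Finset.sum_comm]
  refine Finset.sum_congr rfl fun j hj => ?_
  rw [← sum_legendreCoeff_mul_choose_div (K := ℚ_[p]) h (j + 1) (by simp at hj; omega),
    Finset.sum_mul]
  refine Finset.sum_congr rfl fun k _ => ?_
  ring

theorem sum_legendreCoeff (K : Type*) [Field K] [CharZero K] (h : ℕ) :
    ∑ k ∈ Finset.range (h + 1), legendreCoeff K h k = (-1) ^ h := by
  rw [← sum_legendreCoeff_mul_choose_div (K := K) h 0 (Nat.zero_le h)]
  refine Finset.sum_congr rfl fun k _ => ?_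
  have hc0 : ((2 * k).choose k : K) ≠ 0 := by
    exact_mod_cast (Nat.choose_pos (by omega : k ≤ 2 * k)).ne'
  rw [add_zero, div_self hc0, mul_one]

theorem one_sub_mul_sum_sum_sqCoeff_mem_padicBall {h : ℕ} (hp : p = 2 * h + 1) {y t : ℚ_[p]}
    (hy : ‖y‖ = 1) (ht1 : t ∈ padicBall p 0) (ht : 16 * y * t = (1 - y) ^ 2) :
    (1 - y) * (∑ n ∈ Finset.range p, y ^ n * ∑ k ∈ Finset.range p, sqCoeff ℚ_[p] n k * t ^ k) -
      (-1) ^ h * (1 - y ^ p - p * y ^ p * ∑ j ∈ Finset.range h,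
        (-1) ^ (j + 1) * ((y ^ (j + 1) - y⁻¹ ^ (j + 1)) / ((j + 1 : ℕ) : ℚ_[p]))) ∈
      padicBall p 2 := by
  have hy0 := mem_padicBall_zero hy
  have hswap : ∑ n ∈ Finset.range p, y ^ n * ∑ k ∈ Finset.range p, sqCoeff ℚ_[p] n k * t ^ k =
      ∑ k ∈ Finset.range ((h + 1) + h), ((2 * k).choose k : ℚ_[p]) ^ 2 *
        (t ^ k * ∑ n ∈ Finset.range p, ((n + k).choose (2 * k) : ℚ_[p]) * y ^ n) := by
    rw [show (h + 1) + h = p by omega]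
    simp only [Finset.mul_sum]
    rw [Finset.sum_comm]
    refine Finset.sum_congr rfl fun k _ => Finset.sum_congr rfl fun n _ => ?_
    rw [sqCoeff]
    ring
  have hmain : (-1) ^ h * (1 - y ^ p - p * y ^ p * ∑ j ∈ Finset.range h,
        (-1) ^ (j + 1) * ((y ^ (j + 1) - y⁻¹ ^ (j + 1)) / ((j + 1 : ℕ) : ℚ_[p]))) =
      ∑ k ∈ Finset.range (h + 1), legendreCoeff ℚ_[p] h k *
        (1 - y ^ p * (1 + p * centralSum p h k y)) := by
    have : ∀ k, legendreCoeff ℚ_[p] h k * (1 - y ^ p * (1 + p * centralSum p h k y)) =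
        legendreCoeff ℚ_[p] h k * (1 - y ^ p) -
          p * y ^ p * (legendreCoeff ℚ_[p] h k * centralSum p h k y) := fun k => by ring
    simp only [this]
    rw [Finset.sum_sub_distrib, ← Finset.sum_mul, ← Finset.mul_sum, sum_legendreCoeff,
      sum_legendreCoeff_mul_centralSum]
    ring
  rw [hswap, hmain, Finset.sum_range_add, mul_add, add_sub_right_comm, Finset.mul_sum,
    ← Finset.sum_sub_distrib]
  refine add_mem (sum_mem fun k hk => ?_) (mul_mem_padicBall_left
    (sub_mem one_mem_padicBall hy0) (sum_mem fun k hk => ?_))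
  · have hk' : k ≤ h := by simp at hk; omega
    obtain ⟨N, hN⟩ : ∃ N, k + (N + 1) = p := ⟨p - k - 1, by omega⟩
    have hsum := one_sub_mul_sum_choose_add_mul_pow ht k N
    rw [hN] at hsum
    have hD := mul_choose_mul_sum_mem_padicBall hp hk' (by omega : N + 1 + k = p) hy
    set D := ((N : ℚ_[p]) + 1) * ((N + 1 + 2 * k).choose (2 * k) : ℚ_[p]) *
        ∑ i ∈ Finset.range (2 * k + 1), (-1) ^ i * ((2 * k).choose i : ℚ_[p]) *
          (y ^ (N + 1 + i) / ((N : ℚ_[p]) + 1 + i)) with hDdef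
    have hE := centralSum_mem_padicBall hp hk' hy
    have hA := centralBinom_sq_sub_legendreCoeff hp hk'
    have hW : 1 - y ^ p * (1 + p * centralSum p h k y) ∈ padicBall p 0 :=
      sub_mem one_mem_padicBall (mul_mem_padicBall (pow_mem_padicBall hy0 _)
        (add_mem one_mem_padicBall (mul_mem_padicBall (natCast_mem_padicBall p) hE)))
    have : (1 - y) * (((2 * k).choose k : ℚ_[p]) ^ 2 *
          (t ^ k * ∑ n ∈ Finset.range p, ((n + k).choose (2 * k) : ℚ_[p]) * y ^ n)) -
        legendreCoeff ℚ_[p] h k * (1 - y ^ p * (1 + p * centralSum p h k y)) =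
        (((2 * k).choose k : ℚ_[p]) ^ 2 / 16 ^ k - legendreCoeff ℚ_[p] h k) *
            (1 - y ^ p * (1 + p * centralSum p h k y)) -
          (((2 * k).choose k : ℚ_[p]) ^ 2 / 16 ^ k - legendreCoeff ℚ_[p] h k) *
            (D - y ^ p * (1 + p * centralSum p h k y)) -
          legendreCoeff ℚ_[p] h k * (D - y ^ p * (1 + p * centralSum p h k y)) := by
      rw [mul_left_comm, hsum]
      ring
    rw [this]
    exact sub_mem (sub_mem (mul_mem_padicBall_right hA hW)
      (mul_mem_padicBall_left (padicBall_anti (Nat.zero_le 2) hA) hD))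
      (mul_mem_padicBall_left (legendreCoeff_mem_padicBall h k) hD)
  · have hk' := Finset.mem_range.1 hk
    have hc := natCast_mem_padicBall_one (p := p) (n := (2 * (h + 1 + k)).choose (h + 1 + k))
      (Nat.Prime.dvd_choose Fact.out (by omega) (by omega) (by omega))
    refine mul_mem_padicBall_right (by rw [pow_two]; exact mul_mem_padicBall hc hc)
      (mul_mem_padicBall (pow_mem_padicBall ht1 _) (sum_mem fun n _ =>
        mul_mem_padicBall (natCast_mem_padicBall _) (pow_mem_padicBall hy0 _)))

theorem Ssum_sub_Ssum_mem_padicBall {h : ℕ} (hp : p = 2 * h + 1) {y : ℚ_[p]} (hy : ‖y‖ = 1) :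
    Ssum p ((1 + y) / 4) - Ssum p ((1 + y⁻¹) / 4) - ∑ j ∈ Finset.range h,
      (-1) ^ (j + 1) * ((y ^ (j + 1) - y⁻¹ ^ (j + 1)) / ((j + 1 : ℕ) : ℚ_[p])) ∈
      padicBall p 1 := by
  have hG : ∑ j ∈ Finset.range h,
        (-1) ^ (j + 1) * ((y ^ (j + 1) - y⁻¹ ^ (j + 1)) / ((j + 1 : ℕ) : ℚ_[p])) =
      ∑ j ∈ Finset.range h, ((-y) ^ (j + 1) - 1) / ((j : ℚ_[p]) + 1) -
        ∑ j ∈ Finset.range h, ((-y⁻¹) ^ (j + 1) - 1) / ((j : ℚ_[p]) + 1) := by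
    rw [← Finset.sum_sub_distrib]
    refine Finset.sum_congr rfl fun j _ => ?_
    rw [neg_pow y, neg_pow y⁻¹]
    push_cast
    ring
  rw [hG, sub_sub_sub_comm]
  exact sub_mem (Ssum_sub_sum_mem_padicBall hp (mem_padicBall_zero hy))
    (Ssum_sub_sum_mem_padicBall hp (inv_mem_padicBall hy))

theorem norm_intCast_eq_one {a : ℤ} (ha : ¬(p : ℤ) ∣ a) : ‖(a : ℚ_[p])‖ = 1 :=
  le_antisymm (Padic.norm_int_le_one a) (not_lt.1 fun h => ha (Padic.norm_intCast_lt_one_iff.1 h))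

end PadicCongruence

theorem sum_sq_div_m_pow (p : ℕ) [Fact p.Prime] (hodd : Odd p) (b c d m : ℤ)
    (hd : d = b ^ 2 - 4 * c) (hm : (m - d) ^ 2 = 16 * m * c)
    (hpmd : ¬ (p : ℤ) ∣ m * d * (m - d)) :
    ‖(∑ k ∈ Finset.range p,
        (genCentralTrinomial b c k : ℚ_[p]) ^ 2 / (m : ℚ_[p]) ^ k) -
      ((-1 : ℚ_[p]) ^ ((p - 1) / 2) +
        (p : ℚ_[p]) * (d : ℚ_[p]) / ((d : ℚ_[p]) - (m : ℚ_[p])) *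
          (-1 : ℚ_[p]) ^ ((p - 1) / 2) *
          (fermatQuotient p d - fermatQuotient p m +
            Ssum p (((m : ℚ_[p]) + (d : ℚ_[p])) / (4 * (m : ℚ_[p]))) -
            Ssum p (((m : ℚ_[p]) + (d : ℚ_[p])) / (4 * (d : ℚ_[p])))))‖ ≤
      (p : ℝ)⁻¹ ^ 2 := by
  obtain ⟨h, hp⟩ := hodd
  have hpm : ¬(p : ℤ) ∣ m := fun hdvd => hpmd ((hdvd.mul_right d).mul_right _)
  have hpd : ¬(p : ℤ) ∣ d := fun hdvd => hpmd ((hdvd.mul_left m).mul_right _)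
  have hmn := norm_intCast_eq_one hpm
  have hdn := norm_intCast_eq_one hpd
  have hmdn := norm_intCast_eq_one fun hdvd => hpmd (hdvd.mul_left (m * d))
  push_cast at hmdn
  have hp0 : (p : ℚ_[p]) ≠ 0 := by exact_mod_cast (Fact.out : p.Prime).ne_zero
  have hm0 : (m : ℚ_[p]) ≠ 0 := norm_ne_zero_iff.1 (by rw [hmn]; exact one_ne_zero)
  have hd0 : (d : ℚ_[p]) ≠ 0 := norm_ne_zero_iff.1 (by rw [hdn]; exact one_ne_zero)
  have hmd0 : (m : ℚ_[p]) - d ≠ 0 := norm_ne_zero_iff.1 (by rw [hmdn]; exact one_ne_zero)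
  have hdm0 : (d : ℚ_[p]) - m ≠ 0 := sub_ne_zero.2 (sub_ne_zero.1 hmd0).symm
  have hmc : ((m : ℚ_[p]) - d) ^ 2 = 16 * m * c := by
    exact_mod_cast congrArg (Int.cast (R := ℚ_[p])) hm
  have hdc : (d : ℚ_[p]) = (b : ℚ_[p]) ^ 2 - 4 * c := by
    exact_mod_cast congrArg (Int.cast (R := ℚ_[p])) hd
  obtain ⟨y, hydef⟩ : ∃ y : ℚ_[p], y = d / m := ⟨_, rfl⟩
  obtain ⟨t, htdef⟩ : ∃ t : ℚ_[p], t = c / d := ⟨_, rfl⟩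
  have hy : ‖y‖ = 1 := by rw [hydef, norm_div, hmn, hdn, div_one]
  have hy1 : 1 - y = (m - d) / m := by rw [hydef]; field_simp
  have hyn : ‖1 - y‖ = 1 := by rw [hy1, norm_div, hmn, hmdn, div_one]
  have ht : (c : ℚ_[p]) = d * t := by rw [htdef]; field_simp
  have ht1 : t ∈ padicBall p 0 := by
    rw [htdef, div_eq_mul_inv]
    exact mul_mem_padicBall (intCast_mem_padicBall c) (inv_mem_padicBall hdn)
  have hty : 16 * y * t = (1 - y) ^ 2 := by
    rw [hy1, div_pow, hmc, hydef, htdef]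
    field_simp
  have hS : ∑ k ∈ Finset.range p, (genCentralTrinomial b c k : ℚ_[p]) ^ 2 / (m : ℚ_[p]) ^ k =
      ∑ n ∈ Finset.range p, y ^ n * ∑ k ∈ Finset.range p, sqCoeff ℚ_[p] n k * t ^ k := by
    refine Finset.sum_congr rfl fun n hn => ?_
    rw [genCentralTrinomial_sq b c hdc ht (Finset.mem_range.1 hn), hydef, div_pow]
    ring
  have hx1 : ((m : ℚ_[p]) + d) / (4 * m) = (1 + y) / 4 := by rw [hydef]; field_simp
  have hx2 : ((m : ℚ_[p]) + d) / (4 * d) = (1 + y⁻¹) / 4 := by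
    rw [hydef]; field_simp; ring
  have hcoef : (p : ℚ_[p]) * d / (d - m) = -(p * y * (1 - y)⁻¹) := by
    rw [hy1, hydef, ← neg_sub (m : ℚ_[p])]; field_simp
  have hmain := one_sub_mul_sum_sum_sqCoeff_mem_padicBall hp hy ht1 hty
  have hSS := Ssum_sub_Ssum_mem_padicBall hp hy
  have hG : ∑ j ∈ Finset.range h,
      (-1) ^ (j + 1) * ((y ^ (j + 1) - y⁻¹ ^ (j + 1)) / ((j + 1 : ℕ) : ℚ_[p])) ∈
      padicBall p 0 := by
    refine sum_mem fun j hj => mul_mem_padicBall_left (neg_one_pow_mem_padicBall _) ?_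
    rw [div_eq_mul_inv _ ((j + 1 : ℕ) : ℚ_[p])]
    exact mul_mem_padicBall (sub_mem (pow_mem_padicBall (mem_padicBall_zero hy) _)
      (pow_mem_padicBall (inv_mem_padicBall hy) _)) (inv_mem_padicBall
        (norm_natCast_eq_one_of_lt (Nat.succ_ne_zero j) (by simp at hj; omega)))
  have hv := intCast_pow_sub_one_mem_padicBall hpm
  have hw : y ^ (p - 1) - 1 ∈ padicBall p 1 := by
    have : y ^ (p - 1) - 1 = (((d : ℚ_[p]) ^ (p - 1) - 1) - ((m : ℚ_[p]) ^ (p - 1) - 1)) *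
        ((m : ℚ_[p])⁻¹) ^ (p - 1) := by
      rw [hydef, div_pow, inv_pow]; field_simp; ring
    rw [this]
    exact mul_mem_padicBall_right (sub_mem (intCast_pow_sub_one_mem_padicBall hpd) hv)
      (pow_mem_padicBall (inv_mem_padicBall hmn) _)
  have hq : (p : ℚ_[p]) * (fermatQuotient p d - fermatQuotient p m) =
      (m : ℚ_[p]) ^ (p - 1) * (y ^ (p - 1) - 1) := by
    rw [fermatQuotient, fermatQuotient, hydef, div_pow]; field_simp; ring
  have hyp : y ^ p = y * y ^ (p - 1) := by
    rw [← pow_succ', Nat.sub_add_cancel (Fact.out : p.Prime).one_le]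
  rw [show (p - 1) / 2 = h by omega, hx1, hx2, hS, hcoef, ← mem_padicBall]
  set G := ∑ j ∈ Finset.range h,
      (-1) ^ (j + 1) * ((y ^ (j + 1) - y⁻¹ ^ (j + 1)) / ((j + 1 : ℕ) : ℚ_[p]))
  set S := ∑ n ∈ Finset.range p, y ^ n * ∑ k ∈ Finset.range p, sqCoeff ℚ_[p] n k * t ^ k
  have hy0 : 1 - y ≠ 0 := norm_ne_zero_iff.1 (by rw [hyn]; exact one_ne_zero)
  refine mem_padicBall_of_mul hyn ?_
  have : (1 - y) * (S - ((-1) ^ h + -(p * y * (1 - y)⁻¹) * (-1) ^ h *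
        (fermatQuotient p d - fermatQuotient p m + Ssum p ((1 + y) / 4) -
          Ssum p ((1 + y⁻¹) / 4)))) =
      ((1 - y) * S - (-1) ^ h * (1 - y ^ p - p * y ^ p * G)) +
        (-1) ^ h * (y * (p * (Ssum p ((1 + y) / 4) - Ssum p ((1 + y⁻¹) / 4) - G) -
          p * (y ^ (p - 1) - 1) * G +
          ((m : ℚ_[p]) ^ (p - 1) - 1) * (y ^ (p - 1) - 1))) := by
    rw [hyp]
    have hcancel : (1 - y) * (1 - y)⁻¹ = 1 := mul_inv_cancel₀ hy0
    linear_combination (p * y * (-1) ^ h * (fermatQuotient p d - fermatQuotient p m +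
      Ssum p ((1 + y) / 4) - Ssum p ((1 + y⁻¹) / 4))) * hcancel + y * (-1) ^ h * hq
  rw [this]
  exact add_mem hmain (mul_mem_padicBall_left (neg_one_pow_mem_padicBall h)
    (mul_mem_padicBall_left (mem_padicBall_zero hy)
      (add_mem (sub_mem (mul_mem_padicBall prime_mem_padicBall hSS)
        (mul_mem_padicBall_right (mul_mem_padicBall prime_mem_padicBall hw) hG))
        (mul_mem_padicBall hv hw))))
end

section
/- Let p be an odd prime. Then ∑_{k=0}^{p-1} T_k(2,2)^2 / 4^k ≡ ∑_{k=0}^{p-1} binom(2k,k)^2 / 8^k (mod p^2), both sides being p-adic integers. -/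
section Coefficients

variable {K : Type*} [Field K] [CharZero K]

/-- The coefficient of `w ^ k` in `T_n(1, w)`. -/
def trinomialCoeff (K : Type*) [Field K] (n k : ℕ) : K :=
  (n.choose (2 * k) : K) * ((2 * k).choose k : K)

/-- The coefficient of `z ^ k` in `P_n(x) ^ 2`, where `z = (x ^ 2 - 1) / 4`. -/
def legendreSqCoeff (K : Type*) [Field K] (n k : ℕ) : K :=
  ((n + k).choose (2 * k) : K) * ((2 * k).choose k : K) ^ 2

theorem cast_choose_succ_right_mul (n k : ℕ) :
    (n.choose (k + 1) : K) * (k + 1) = n.choose k * ((n : K) - k) := by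
  rcases le_or_gt k n with h | h
  · have := Nat.choose_succ_right_eq n k
    rw [← Nat.cast_sub h]
    exact_mod_cast this
  · rw [Nat.choose_eq_zero_of_lt h, Nat.choose_eq_zero_of_lt (by omega)]
    simp

theorem cast_choose_succ_left_mul (n k : ℕ) :
    ((n + 1).choose k : K) * ((n : K) + 1 - k) = n.choose k * ((n : K) + 1) := by
  rcases le_or_gt k (n + 1) with h | h
  · have := Nat.choose_mul_succ_eq n k
    have e : ((n : K) + 1 - k) = ((n + 1 - k : ℕ) : K) := by
      rw [Nat.cast_sub h]; push_cast; ring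
    rw [e]
    exact_mod_cast this.symm
  · rw [Nat.choose_eq_zero_of_lt h, Nat.choose_eq_zero_of_lt (by omega)]
    simp

theorem cast_centralBinom_succ_mul (k : ℕ) :
    ((2 * (k + 1)).choose (k + 1) : K) * (k + 1) = 2 * (2 * k + 1) * (2 * k).choose k := by
  have := Nat.succ_mul_centralBinom_succ k
  simp only [Nat.centralBinom] at this
  rw [mul_comm]
  exact_mod_cast this

theorem cast_choose_two_mul_succ_mul (n k : ℕ) :
    (n.choose (2 * (k + 1)) : K) * (2 * (k + 1) * (2 * k + 1)) =
      n.choose (2 * k) * (((n : K) - 2 * k) * (n - 2 * k - 1)) := by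
  have h1 := cast_choose_succ_right_mul (K := K) n (2 * k)
  have h2 := cast_choose_succ_right_mul (K := K) n (2 * k + 1)
  rw [show 2 * (k + 1) = 2 * k + 1 + 1 by ring]
  push_cast at h1 h2
  linear_combination (2 * (k : K) + 1) * h2 + ((n : K) - 2 * k - 1) * h1

theorem trinomialCoeff_succ_left (n k : ℕ) :
    trinomialCoeff K (n + 1) k * ((n : K) + 1 - 2 * k) = trinomialCoeff K n k * (n + 1) := by
  have := cast_choose_succ_left_mul (K := K) n (2 * k)
  push_cast at this
  unfold trinomialCoeff
  linear_combination ((2 * k).choose k : K) * this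

theorem trinomialCoeff_succ_right (n k : ℕ) :
    trinomialCoeff K n (k + 1) * ((k : K) + 1) ^ 2 =
      trinomialCoeff K n k * (((n : K) - 2 * k) * (n - 2 * k - 1)) := by
  have h1 := cast_choose_two_mul_succ_mul (K := K) n k
  have h2 := cast_centralBinom_succ_mul (K := K) k
  unfold trinomialCoeff
  linear_combination ((2 * k).choose k : K) * h1 +
    (n.choose (2 * (k + 1)) : K) * (k + 1) * h2

theorem trinomialCoeff_recurrence_zero {K : Type*} [Field K] (n : ℕ) :
    ((n : K) + 2) * trinomialCoeff K (n + 2) 0 =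
      (2 * n + 3) * trinomialCoeff K (n + 1) 0 - (n + 1) * trinomialCoeff K n 0 := by
  simp [trinomialCoeff]
  ring

theorem trinomialCoeff_recurrence_succ (n k : ℕ) :
    ((n : K) + 2) * trinomialCoeff K (n + 2) (k + 1) =
      (2 * n + 3) * trinomialCoeff K (n + 1) (k + 1) -
        (n + 1) * (trinomialCoeff K n (k + 1) - 4 * trinomialCoeff K n k) := by
  have hk : ((k : K) + 1) ^ 2 ≠ 0 := pow_ne_zero 2 (Nat.cast_add_one_ne_zero k)
  apply mul_right_cancel₀ hk
  have h0 := trinomialCoeff_succ_right (K := K) n k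
  have h1 := trinomialCoeff_succ_right (K := K) (n + 1) k
  have h2 := trinomialCoeff_succ_right (K := K) (n + 2) k
  have e0 := trinomialCoeff_succ_left (K := K) n k
  have e1 := trinomialCoeff_succ_left (K := K) (n + 1) k
  push_cast at h1 h2 e1
  rw [show n + 1 + 1 = n + 2 from rfl] at e1
  linear_combination ((n : K) + 2) * h2 - (2 * n + 3) * h1 + (n + 1) * h0
    + ((n : K) + 2) * (n + 1 - 2 * k) * e1
    + (((n : K) + 2) * (n + 2) - (2 * n + 3) * (n - 2 * k)) * e0

theorem legendreSqCoeff_succ_left (n k : ℕ) :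
    legendreSqCoeff K (n + 1) k * ((n : K) + 1 - k) = legendreSqCoeff K n k * (n + 1 + k) := by
  have := cast_choose_succ_left_mul (K := K) (n + k) (2 * k)
  rw [show n + k + 1 = n + 1 + k by ring] at this
  push_cast at this
  unfold legendreSqCoeff
  linear_combination ((2 * k).choose k : K) ^ 2 * this

theorem legendreSqCoeff_succ_right (n k : ℕ) :
    legendreSqCoeff K n (k + 1) * ((k : K) + 1) ^ 3 =
      legendreSqCoeff K n k * (2 * (2 * k + 1) * (n + k + 1) * (n - k)) := by
  have hk : 2 * (2 * (k : K) + 1) ≠ 0 :=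
    mul_ne_zero two_ne_zero (by exact_mod_cast (2 * k).succ_ne_zero)
  apply mul_right_cancel₀ hk
  have h1 := cast_choose_two_mul_succ_mul (K := K) (n + (k + 1)) k
  have h2 := cast_centralBinom_succ_mul (K := K) k
  have h3 := cast_choose_succ_left_mul (K := K) (n + k) (2 * k)
  rw [show n + k + 1 = n + (k + 1) by ring] at h3
  push_cast at h1 h3
  unfold legendreSqCoeff
  set B := ((2 * (k + 1)).choose (k + 1) : K)
  set A := ((2 * k).choose k : K)
  set C := ((n + (k + 1)).choose (2 * (k + 1)) : K)
  linear_combination (B * (k + 1)) ^ 2 * h1 +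
    ((n + (k + 1)).choose (2 * k) : K) * (n - k + 1) * (n - k) *
      (B * (k + 1) + 2 * (2 * k + 1) * A) * h2 +
    4 * (2 * (k : K) + 1) ^ 2 * A ^ 2 * (n - k) * h3

theorem legendreSqCoeff_recurrence_zero {K : Type*} [Field K] (n : ℕ) :
    ((n : K) + 2) ^ 2 * legendreSqCoeff K (n + 2) 0 =
      (2 * n + 3) ^ 2 * legendreSqCoeff K (n + 1) 0 -
        2 * (2 * n + 3) * ((n + 1) * legendreSqCoeff K (n + 1) 0) +
        (n + 1) ^ 2 * legendreSqCoeff K n 0 := by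
  simp [legendreSqCoeff]
  ring

theorem legendreSqCoeff_recurrence_succ (n k : ℕ) :
    ((n : K) + 2) ^ 2 * legendreSqCoeff K (n + 2) (k + 1) =
      (2 * n + 3) ^ 2 *
          (legendreSqCoeff K (n + 1) (k + 1) + 4 * legendreSqCoeff K (n + 1) k) -
        2 * (2 * n + 3) * ((n - k) * legendreSqCoeff K (n + 1) (k + 1) +
          4 * ((n + 1 - k) * legendreSqCoeff K (n + 1) k)) +
        (n + 1) ^ 2 * legendreSqCoeff K n (k + 1) := by
  have hk : ((k : K) + 1) ^ 3 ≠ 0 := pow_ne_zero 3 (Nat.cast_add_one_ne_zero k)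
  apply mul_right_cancel₀ hk
  have h0 := legendreSqCoeff_succ_right (K := K) n k
  have h1 := legendreSqCoeff_succ_right (K := K) (n + 1) k
  have h2 := legendreSqCoeff_succ_right (K := K) (n + 2) k
  have e0 := legendreSqCoeff_succ_left (K := K) n k
  have e1 := legendreSqCoeff_succ_left (K := K) (n + 1) k
  push_cast at h1 h2 e1
  rw [show n + 1 + 1 = n + 2 from rfl] at e1
  linear_combination ((n : K) + 2) ^ 2 * h2
    - ((2 * n + 3) ^ 2 - 2 * (2 * n + 3) * (n - k)) * h1 - (n + 1) ^ 2 * h0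
    + ((n : K) + 2) ^ 2 * (2 * (2 * k + 1)) * (n + k + 3) * e1
    + ((n : K) + 1) ^ 2 * (2 * (2 * k + 1)) * (n - k) * e0

theorem trinomialCoeff_eq_zero {n k : ℕ} (h : n < 2 * k) : trinomialCoeff K n k = 0 := by
  simp [trinomialCoeff, Nat.choose_eq_zero_of_lt h]

theorem legendreSqCoeff_eq_zero {n k : ℕ} (h : n < k) : legendreSqCoeff K n k = 0 := by
  simp [legendreSqCoeff, Nat.choose_eq_zero_of_lt (show n + k < 2 * k by omega)]

theorem trinomial_sum_recurrence (w : K) {n N : ℕ} (h : n + 2 ≤ N) :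
    ((n : K) + 2) * ∑ k ∈ Finset.range (N + 1), trinomialCoeff K (n + 2) k * w ^ k =
      (2 * n + 3) * ∑ k ∈ Finset.range (N + 1), trinomialCoeff K (n + 1) k * w ^ k -
        (n + 1) * (1 - 4 * w) * ∑ k ∈ Finset.range (N + 1), trinomialCoeff K n k * w ^ k := by
  have hs : 4 * w * ∑ k ∈ Finset.range (N + 1), trinomialCoeff K n k * w ^ k =
      ∑ k ∈ Finset.range N, 4 * trinomialCoeff K n k * w ^ (k + 1) := by
    rw [Finset.sum_range_succ, trinomialCoeff_eq_zero (by omega), zero_mul, add_zero,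
      Finset.mul_sum]
    exact Finset.sum_congr rfl fun k _ => by ring
  have hsum : ((n : K) + 2) * ∑ k ∈ Finset.range N, trinomialCoeff K (n + 2) (k + 1) * w ^ (k + 1)
      = (2 * n + 3) * ∑ k ∈ Finset.range N, trinomialCoeff K (n + 1) (k + 1) * w ^ (k + 1)
        - (n + 1) * (∑ k ∈ Finset.range N, trinomialCoeff K n (k + 1) * w ^ (k + 1)
          - ∑ k ∈ Finset.range N, 4 * trinomialCoeff K n k * w ^ (k + 1)) := by
    simp only [Finset.mul_sum, ← Finset.sum_sub_distrib]
    refine Finset.sum_congr rfl fun k _ => ?_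
    linear_combination w ^ (k + 1) * trinomialCoeff_recurrence_succ (K := K) n k
  have h0 := trinomialCoeff_recurrence_zero (K := K) n
  rw [← hs] at hsum
  simp only [Finset.sum_range_succ' _ N, pow_zero, mul_one] at hsum ⊢
  linear_combination hsum + h0

/-- The recurrence satisfied by `P_n(x) ^ 2` and `P_{n+1}(x) P_n(x) / x`, as sums over `z`. -/
theorem legendreSq_sum_recurrence (z : K) {n N : ℕ} (h : n + 2 ≤ N) :
    ((n : K) + 2) ^ 2 * ∑ k ∈ Finset.range (N + 1), legendreSqCoeff K (n + 2) k * z ^ k =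
      (1 + 4 * z) *
        ((2 * n + 3) ^ 2 * ∑ k ∈ Finset.range (N + 1), legendreSqCoeff K (n + 1) k * z ^ k -
          2 * (2 * n + 3) * ∑ k ∈ Finset.range (N + 1),
            ((n : K) + 1 - k) * legendreSqCoeff K (n + 1) k * z ^ k) +
        (n + 1) ^ 2 * ∑ k ∈ Finset.range (N + 1), legendreSqCoeff K n k * z ^ k := by
  have hs : 4 * z * ∑ k ∈ Finset.range (N + 1), legendreSqCoeff K (n + 1) k * z ^ k =
      ∑ k ∈ Finset.range N, 4 * legendreSqCoeff K (n + 1) k * z ^ (k + 1) := by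
    rw [Finset.sum_range_succ, legendreSqCoeff_eq_zero (by omega), zero_mul, add_zero,
      Finset.mul_sum]
    exact Finset.sum_congr rfl fun k _ => by ring
  have hs' : 4 * z * ∑ k ∈ Finset.range (N + 1),
        ((n : K) + 1 - k) * legendreSqCoeff K (n + 1) k * z ^ k =
      ∑ k ∈ Finset.range N, 4 * (((n : K) + 1 - k) * legendreSqCoeff K (n + 1) k) * z ^ (k + 1) := by
    rw [Finset.sum_range_succ, legendreSqCoeff_eq_zero (by omega), mul_zero, zero_mul, add_zero,
      Finset.mul_sum]
    exact Finset.sum_congr rfl fun k _ => by ring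
  have hsum : ((n : K) + 2) ^ 2 *
        ∑ k ∈ Finset.range N, legendreSqCoeff K (n + 2) (k + 1) * z ^ (k + 1) =
      (2 * n + 3) ^ 2 * (∑ k ∈ Finset.range N, legendreSqCoeff K (n + 1) (k + 1) * z ^ (k + 1) +
          ∑ k ∈ Finset.range N, 4 * legendreSqCoeff K (n + 1) k * z ^ (k + 1)) -
        2 * (2 * n + 3) *
          (∑ k ∈ Finset.range N,
              ((n : K) + 1 - (k + 1 : ℕ)) * legendreSqCoeff K (n + 1) (k + 1) * z ^ (k + 1) +
            ∑ k ∈ Finset.range N,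
              4 * (((n : K) + 1 - k) * legendreSqCoeff K (n + 1) k) * z ^ (k + 1)) +
        (n + 1) ^ 2 * ∑ k ∈ Finset.range N, legendreSqCoeff K n (k + 1) * z ^ (k + 1) := by
    simp only [← Finset.sum_add_distrib, Finset.mul_sum, ← Finset.sum_sub_distrib]
    refine Finset.sum_congr rfl fun k _ => ?_
    push_cast
    linear_combination z ^ (k + 1) * legendreSqCoeff_recurrence_succ (K := K) n k
  have h0 := legendreSqCoeff_recurrence_zero (K := K) n
  rw [← hs, ← hs'] at hsum
  simp only [Finset.sum_range_succ' _ N, pow_zero, mul_one, Nat.cast_zero, sub_zero] at hsum ⊢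
  linear_combination hsum + h0

theorem trinomial_sum_sq_aux (N : ℕ) : ∀ n : ℕ, n + 1 ≤ N →
    (∑ k ∈ Finset.range (N + 1), trinomialCoeff K n k * (1 / 2) ^ k) ^ 2 =
        (-1) ^ n * ∑ k ∈ Finset.range (N + 1), legendreSqCoeff K n k * (-1 / 2) ^ k ∧
    (∑ k ∈ Finset.range (N + 1), trinomialCoeff K (n + 1) k * (1 / 2) ^ k) ^ 2 =
        (-1) ^ (n + 1) *
          ∑ k ∈ Finset.range (N + 1), legendreSqCoeff K (n + 1) k * (-1 / 2) ^ k ∧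
    ((n : K) + 1) * ((∑ k ∈ Finset.range (N + 1), trinomialCoeff K (n + 1) k * (1 / 2) ^ k) *
          ∑ k ∈ Finset.range (N + 1), trinomialCoeff K n k * (1 / 2) ^ k) =
        (-1) ^ n * ∑ k ∈ Finset.range (N + 1),
          ((n : K) + 1 - k) * legendreSqCoeff K (n + 1) k * (-1 / 2) ^ k := by
  intro n
  induction n with
  | zero =>
    intro h
    obtain ⟨M, rfl⟩ : ∃ M, N = M + 1 := ⟨N - 1, by omega⟩
    have ht (n : ℕ) (hn : n ≤ 1) : ∑ k ∈ Finset.range (M + 1 + 1),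
        trinomialCoeff K n k * (1 / 2) ^ k = 1 := by
      rw [Finset.sum_range_succ', Finset.sum_eq_zero]
      · simp [trinomialCoeff]
      · intro k _
        rw [trinomialCoeff_eq_zero (by omega), zero_mul]
    have hl (c : ℕ → K) (n : ℕ) (hn : n ≤ 1) : ∑ k ∈ Finset.range (M + 1 + 1),
        c k * legendreSqCoeff K n k * (-1 / 2) ^ k =
          c 0 + c 1 * legendreSqCoeff K n 1 * (-1 / 2) := by
      rw [Finset.sum_range_succ', Finset.sum_range_succ', Finset.sum_eq_zero]
      · simp [legendreSqCoeff]; ring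
      · intro k _
        rw [legendreSqCoeff_eq_zero (by omega), mul_zero, zero_mul]
    have hl1 := hl (fun _ => 1)
    simp only [one_mul] at hl1
    rw [ht 0 (by omega), ht (0 + 1) (by omega), hl1 0 (by omega), hl1 (0 + 1) (by omega),
      hl (fun k => ((0 : ℕ) : K) + 1 - k) (0 + 1) (by omega)]
    refine ⟨?_, ?_, ?_⟩ <;> norm_num [legendreSqCoeff, Nat.choose]
  | succ n ih =>
    intro h
    obtain ⟨i0, i1, i2⟩ := ih (by omega)
    have hT := trinomial_sum_recurrence (K := K) (1 / 2) (n := n) (N := N) (by omega)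
    have hL := legendreSq_sum_recurrence (K := K) (-1 / 2) (n := n) (N := N) (by omega)
    have hV : ∑ k ∈ Finset.range (N + 1),
        (((n + 1 : ℕ) : K) + 1 - k) * legendreSqCoeff K (n + 1 + 1) k * (-1 / 2) ^ k =
        (2 * n + 3) * ∑ k ∈ Finset.range (N + 1), legendreSqCoeff K (n + 1) k * (-1 / 2) ^ k -
        ∑ k ∈ Finset.range (N + 1),
          ((n : K) + 1 - k) * legendreSqCoeff K (n + 1) k * (-1 / 2) ^ k := by
      simp only [Finset.mul_sum, ← Finset.sum_sub_distrib]
      refine Finset.sum_congr rfl fun k _ => ?_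
      have := legendreSqCoeff_succ_left (K := K) (n + 1) k
      push_cast at this ⊢
      linear_combination (-1 / 2) ^ k * this
    refine ⟨i1, ?_, ?_⟩
    · have hn : ((n : K) + 2) ^ 2 ≠ 0 :=
        pow_ne_zero 2 (by exact_mod_cast (n + 1).succ_ne_zero)
      apply mul_left_cancel₀ hn
      rw [show n + 1 + 1 = n + 2 from rfl]
      generalize ∑ k ∈ Finset.range (N + 1), trinomialCoeff K (n + 2) k * (1 / 2) ^ k = t2 at *
      generalize ∑ k ∈ Finset.range (N + 1), trinomialCoeff K (n + 1) k * (1 / 2) ^ k = t1 at *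
      generalize ∑ k ∈ Finset.range (N + 1), trinomialCoeff K n k * (1 / 2) ^ k = t0 at *
      have hsq : (((n : K) + 2) * t2) ^ 2 = ((2 * n + 3) * t1 + (n + 1) * t0) ^ 2 := by
        rw [hT]; ring
      rw [pow_succ] at i1
      rw [pow_add]
      linear_combination hsq + (2 * (n : K) + 3) ^ 2 * i1 + (n + 1) ^ 2 * i0
        + 2 * (2 * n + 3) * i2 - (-1) ^ n * hL
    · rw [hV, show n + 1 + 1 = n + 2 from rfl]
      generalize ∑ k ∈ Finset.range (N + 1), trinomialCoeff K (n + 2) k * (1 / 2) ^ k = t2 at *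
      generalize ∑ k ∈ Finset.range (N + 1), trinomialCoeff K (n + 1) k * (1 / 2) ^ k = t1 at *
      generalize ∑ k ∈ Finset.range (N + 1), trinomialCoeff K n k * (1 / 2) ^ k = t0 at *
      rw [pow_succ] at i1 ⊢
      push_cast
      linear_combination t1 * hT + (2 * (n : K) + 3) * i1 + i2

theorem genCentralTrinomial_two_two_eq {n N : ℕ} (h : n ≤ N) :
    (genCentralTrinomial 2 2 n : K) =
      2 ^ n * ∑ k ∈ Finset.range (N + 1), trinomialCoeff K n k * (1 / 2) ^ k := by
  rw [← Finset.sum_subset (Finset.range_subset_range.mpr (show n / 2 + 1 ≤ N + 1 by omega))]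
  · unfold genCentralTrinomial trinomialCoeff
    push_cast
    rw [Finset.mul_sum]
    refine Finset.sum_congr rfl fun k hk => ?_
    have hk : 2 * k ≤ n := by rw [Finset.mem_range] at hk; omega
    have hp : (2 : K) ^ n = 2 ^ (n - 2 * k) * 2 ^ k * 2 ^ k := by
      rw [← pow_add, ← pow_add]; congr 1; omega
    rw [hp, one_div, inv_pow]
    field_simp
  · intro k _ hk
    rw [trinomialCoeff_eq_zero (by rw [Finset.mem_range] at hk; omega), zero_mul]

theorem genCentralTrinomial_two_two_sq_div {n N : ℕ} (h : n < N) :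
    (genCentralTrinomial 2 2 n : K) ^ 2 / 4 ^ n =
      (-1) ^ n * ∑ k ∈ Finset.range N, legendreSqCoeff K n k * (-1 / 2) ^ k := by
  have h1 := (trinomial_sum_sq_aux (K := K) N n h).1
  rw [Finset.sum_range_succ (fun k => legendreSqCoeff K n k * (-1 / 2) ^ k),
    legendreSqCoeff_eq_zero h, zero_mul, add_zero] at h1
  rw [genCentralTrinomial_two_two_eq h.le, mul_pow, h1, ← pow_mul, mul_comm n 2, pow_mul,
    show (2 : K) ^ 2 = 4 by norm_num, mul_div_cancel_left₀ _ (pow_ne_zero n (by norm_num))]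

end Coefficients

/-- The alternating sum `∑_{k < n} (-1)^k * binom(k+j, 2j)`. -/
def altChooseSum (n j : ℕ) : ℤ :=
  ∑ k ∈ Finset.range n, (-1) ^ k * ((k + j).choose (2 * j) : ℤ)

theorem altChooseSum_zero_right {n : ℕ} (hn : Odd n) : altChooseSum n 0 = 1 := by
  obtain ⟨m, rfl⟩ := hn
  simp only [altChooseSum, mul_zero, Nat.choose_zero_right, Nat.cast_one, mul_one]
  induction m with
  | zero => simp
  | succ m ih =>
    rw [show 2 * (m + 1) + 1 = 2 * m + 1 + 1 + 1 by ring, Finset.sum_range_succ,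
      Finset.sum_range_succ, ih]
    simp [pow_succ, pow_mul]

theorem altChooseSum_succ_right (n j : ℕ) :
    4 * altChooseSum n (j + 1) + altChooseSum n j =
      -(-1) ^ n * ((n + j + 1).choose (2 * j + 2) + (n + j).choose (2 * j + 2) : ℤ) := by
  induction n with
  | zero =>
    simp [altChooseSum, Nat.choose_eq_zero_of_lt (show j + 1 < 2 * j + 2 by omega),
      Nat.choose_eq_zero_of_lt (show j < 2 * j + 2 by omega)]
  | succ n ih =>
    unfold altChooseSum at ih ⊢
    rw [Finset.sum_range_succ, Finset.sum_range_succ]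
    have h1 : (n + j + 2).choose (2 * j + 2) =
        (n + j + 1).choose (2 * j + 1) + (n + j + 1).choose (2 * j + 2) :=
      Nat.choose_succ_succ _ _
    have h2 : (n + j + 1).choose (2 * j + 1) = (n + j).choose (2 * j) + (n + j).choose (2 * j + 1) :=
      Nat.choose_succ_succ _ _
    have h3 : (n + j + 1).choose (2 * j + 2) =
        (n + j).choose (2 * j + 1) + (n + j).choose (2 * j + 2) :=
      Nat.choose_succ_succ _ _
    rw [show n + 1 + j + 1 = n + j + 2 by ring, show n + 1 + j = n + j + 1 by ring,
      show n + (j + 1) = n + j + 1 by ring, show 2 * (j + 1) = 2 * j + 2 by ring, pow_succ]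
    zify at h1 h2 h3
    linear_combination ih + (-1) ^ n * (-h1 - h2 + h3)

theorem sq_dvd_choose_add_choose {p j : ℕ} (hp : p.Prime) (hj : 2 * (j + 1) < p) :
    p ^ 2 ∣ (p + j + 1).choose (2 * j + 2) + (p + j).choose (2 * j + 2) := by
  have hc : p ∣ (p + j).choose (2 * j + 1) := hp.dvd_choose (by omega) (by omega) (by omega)
  have h1 : (p + j + 1).choose (2 * j + 2) =
      (p + j).choose (2 * j + 1) + (p + j).choose (2 * j + 2) := Nat.choose_succ_succ _ _
  have h2 := Nat.choose_succ_right_eq (p + j) (2 * j + 1)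
  have h3 : (j + 1) * ((p + j + 1).choose (2 * j + 2) + (p + j).choose (2 * j + 2)) =
      p * (p + j).choose (2 * j + 1) := by
    obtain ⟨m, hm⟩ : ∃ m, p = m + (j + 1) := ⟨p - (j + 1), by omega⟩
    rw [show p + j - (2 * j + 1) = m by omega] at h2
    rw [h1]
    zify at h2 hm ⊢
    linear_combination h2 - ((p + j).choose (2 * j + 1) : ℤ) * hm
  refine Nat.Coprime.dvd_of_dvd_mul_left (m := j + 1) ?_ ?_
  · exact Nat.Coprime.pow_left 2 (Nat.coprime_of_lt_prime (by omega) (by omega) hp)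
  · rw [h3, pow_two]
    exact Nat.mul_dvd_mul_left p hc

theorem sq_dvd_four_pow_mul_altChooseSum_sub {p : ℕ} (hp : p.Prime) (hodd : Odd p) {j : ℕ}
    (hj : 2 * j < p) : (p : ℤ) ^ 2 ∣ 4 ^ j * altChooseSum p j - (-1) ^ j := by
  induction j with
  | zero => simp [altChooseSum_zero_right hodd]
  | succ j ih =>
    have h1 := altChooseSum_succ_right p j
    rw [hodd.neg_one_pow, neg_neg, one_mul] at h1
    have h2 : (p : ℤ) ^ 2 ∣ ((p + j + 1).choose (2 * j + 2) + (p + j).choose (2 * j + 2) : ℤ) := by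
      exact_mod_cast sq_dvd_choose_add_choose hp hj
    rw [← h1] at h2
    have h3 := dvd_sub (h2.mul_left (4 ^ j)) (ih (by omega))
    rw [show (4 : ℤ) ^ (j + 1) * altChooseSum p (j + 1) - (-1) ^ (j + 1) =
      4 ^ j * (4 * altChooseSum p (j + 1) + altChooseSum p j) -
        (4 ^ j * altChooseSum p j - (-1) ^ j) by ring]
    exact h3

theorem sq_dvd_centralBinom_sq_mul {p : ℕ} (hp : p.Prime) (hodd : Odd p) {j : ℕ} (hj : j < p) :
    (p : ℤ) ^ 2 ∣ ((2 * j).choose j : ℤ) ^ 2 * (4 ^ j * altChooseSum p j - (-1) ^ j) := by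
  rcases lt_or_ge (2 * j) p with h | h
  · exact (sq_dvd_four_pow_mul_altChooseSum_sub hp hodd h).mul_left _
  · have : p ∣ (2 * j).choose j := hp.dvd_choose hj (by omega) h
    exact (pow_dvd_pow_of_dvd (Int.natCast_dvd_natCast.mpr this) 2).mul_right _

theorem sum_genCentralTrinomial_sq_div {K : Type*} [Field K] [CharZero K] (N : ℕ) :
    ∑ k ∈ Finset.range N, (genCentralTrinomial 2 2 k : K) ^ 2 / 4 ^ k =
      ∑ j ∈ Finset.range N, ((2 * j).choose j : K) ^ 2 * (-1 / 2) ^ j * altChooseSum N j := by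
  rw [Finset.sum_congr rfl fun k hk =>
    genCentralTrinomial_two_two_sq_div (K := K) (Finset.mem_range.mp hk)]
  simp only [Finset.mul_sum]
  rw [Finset.sum_comm]
  refine Finset.sum_congr rfl fun j _ => ?_
  unfold altChooseSum legendreSqCoeff
  push_cast
  rw [Finset.mul_sum]
  exact Finset.sum_congr rfl fun k _ => by ring

theorem sum_T22_sq_div_four_pow (p : ℕ) [Fact p.Prime] (hodd : Odd p) :
    ‖(∑ k ∈ Finset.range p,
        (genCentralTrinomial 2 2 k : ℚ_[p]) ^ 2 / (4 : ℚ_[p]) ^ k) -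
      ∑ k ∈ Finset.range p, ((2 * k).choose k : ℚ_[p]) ^ 2 / (8 : ℚ_[p]) ^ k‖ ≤
      (p : ℝ)⁻¹ ^ 2 := by
  have hp : p.Prime := Fact.out
  have h8 : ‖(8 : ℚ_[p])‖ = 1 := by
    have : ‖((8 : ℕ) : ℚ_[p])‖ = 1 := by
      rw [Padic.norm_natCast_eq_one_iff, show 8 = 2 ^ 3 by norm_num]
      exact Nat.Coprime.pow_right 3 hodd.coprime_two_right
    exact_mod_cast this
  rw [sum_genCentralTrinomial_sq_div, ← Finset.sum_sub_distrib]
  refine IsUltrametricDist.norm_sum_le_of_forall_le_of_nonneg (by positivity) fun j hj => ?_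
  have hterm : ((2 * j).choose j : ℚ_[p]) ^ 2 * (-1 / 2) ^ j * altChooseSum p j -
      ((2 * j).choose j : ℚ_[p]) ^ 2 / 8 ^ j =
      (((2 * j).choose j : ℤ) ^ 2 * (4 ^ j * altChooseSum p j - (-1) ^ j) : ℤ) *
        (-1) ^ j / 8 ^ j := by
    have h1 : ((-1 : ℚ_[p]) / 2) ^ j = 4 ^ j * (-1) ^ j / 8 ^ j := by
      rw [← mul_pow, ← div_pow]; norm_num
    have h2 : ((-1 : ℚ_[p]) ^ j) * (-1) ^ j = 1 := by rw [← mul_pow]; simp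
    rw [h1]
    push_cast
    linear_combination (-((2 * j).choose j : ℚ_[p]) ^ 2 / 8 ^ j) * (-h2)
  rw [hterm, norm_div, norm_mul, norm_pow, norm_pow, h8]
  simp only [norm_neg, norm_one, one_pow, mul_one, div_one]
  have := (Padic.norm_int_le_pow_iff_dvd (p := p) _ 2).mpr
    (by exact_mod_cast sq_dvd_centralBinom_sq_mul hp hodd (Finset.mem_range.mp hj))
  rw [inv_pow]
  simpa [zpow_neg] using this
end
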